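/- arXiv:1701.07386 — 5 statements merged into one kernel-verified Lean document; each statement's English description precedes it below -/
import Mathlib

section
/- Every 2-edge-connected finite graph G (loops and multiple edges allowed) has an integer 3-flow φ with |supp(φ)| ≥ (3/4)|E(G)|. -/
open Finset

/-- The set of edges with exactly one endpoint in `S` (the edge cut `δ(S)`). -/
def cutset {V E : Type} [Fintype E] [DecidableEq V] (src tgt : E → V) (S : Finset V) :
    Finset E :=
  Finset.univ.filter fun e => (src e ∈ S ∧ tgt e ∉ S) ∨ (tgt e ∈ S ∧ src e ∉ S)

/-- A multigraph (given by endpoint maps `src`, `tgt` on an edge type) is `t`-edge-connected: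
every edge cut determined by a nonempty proper vertex set has at least `t` edges.
(For `t ≥ 1` this is equivalent to being connected with all edge cuts of size at least `t`.) -/
def EdgeConnected {V E : Type} [Fintype V] [Fintype E] [DecidableEq V]
    (src tgt : E → V) (t : ℕ) : Prop :=
  ∀ S : Finset V, S.Nonempty → S ≠ Finset.univ → t ≤ (cutset src tgt S).card

/-- The boundary `∂φ(v) = Σ_{e out of v} φ(e) − Σ_{e into v} φ(e)`. -/
def bdry {V E A : Type} [Fintype E] [DecidableEq V] [AddCommGroup A]
    (src tgt : E → V) (φ : E → A) (v : V) : A :=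
  (∑ e : E, if src e = v then φ e else 0) - (∑ e : E, if tgt e = v then φ e else 0)

/-- The degree of `v` with respect to the edge set `F` (a loop at `v` counts twice). -/
def degr {V E : Type} [DecidableEq V] (src tgt : E → V) (F : Finset E) (v : V) : ℕ :=
  (F.filter fun e => src e = v).card + (F.filter fun e => tgt e = v).card

section Boundary

variable {V E A : Type} [Fintype E] [DecidableEq V] [AddCommGroup A] (src tgt : E → V)

/-- The boundary operator as a homomorphism of additive groups. -/
def bdryHom (A : Type) [AddCommGroup A] : (E → A) →+ (V → A) where
  toFun φ := bdry src tgt φ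
  map_zero' := by ext v; simp [bdry]
  map_add' f g := by
    ext v
    simp only [bdry, Pi.add_apply, ← Finset.sum_sub_distrib, ← Finset.sum_add_distrib]
    refine Finset.sum_congr rfl fun e _ => ?_
    split_ifs <;> abel

lemma bdry_zero : bdry src tgt (0 : E → A) = 0 := map_zero (bdryHom src tgt A)

lemma bdry_add (f g : E → A) :
    bdry src tgt (f + g) = bdry src tgt f + bdry src tgt g := map_add (bdryHom src tgt A) f g

lemma bdry_neg (f : E → A) : bdry src tgt (-f) = -bdry src tgt f := map_neg (bdryHom src tgt A) f

lemma bdry_sub (f g : E → A) :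
    bdry src tgt (f - g) = bdry src tgt f - bdry src tgt g := map_sub (bdryHom src tgt A) f g

lemma bdry_sum {ι : Type} (s : Finset ι) (f : ι → E → A) :
    bdry src tgt (∑ i ∈ s, f i) = ∑ i ∈ s, bdry src tgt (f i) :=
  map_sum (bdryHom src tgt A) f s

lemma bdry_smul {R : Type} [CommRing R] (c : R) (f : E → R) :
    bdry src tgt (c • f) = c • bdry src tgt f := by
  ext v
  simp [bdry, mul_sub, Finset.mul_sum]

lemma bdry_map {B : Type} [AddCommGroup B] (h : A →+ B) (f : E → A) :
    bdry src tgt (fun e => h (f e)) = fun v => h (bdry src tgt f v) := by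
  ext v
  simp only [bdry, map_sub, map_sum]
  congr 1 <;> refine Finset.sum_congr rfl fun e _ => ?_ <;> split_ifs <;> simp

lemma bdry_single [DecidableEq E] (e : E) (a : A) :
    bdry src tgt (Pi.single e a) = Pi.single (src e) a - Pi.single (tgt e) a := by
  ext v
  simp only [bdry, Pi.sub_apply, Pi.single_apply]
  congr 1 <;>
  · rw [Finset.sum_eq_single e]
    · simp [eq_comm]
    · intro b _ hb; simp [hb]
    · simp

lemma sum_bdry (S : Finset V) (f : E → A) :
    ∑ v ∈ S, bdry src tgt f v =
      ∑ e, ((if src e ∈ S then f e else 0) - if tgt e ∈ S then f e else 0) := by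
  simp only [bdry, Finset.sum_sub_distrib]
  congr 1 <;> rw [Finset.sum_comm] <;> simp

/-- Restricting a function to the edges inside a vertex set not crossed by its support
restricts its boundary. -/
lemma bdry_restrict (S : Finset V) (f : E → A)
    (hf : ∀ e, f e ≠ 0 → (src e ∈ S ↔ tgt e ∈ S)) :
    bdry src tgt (fun e => if src e ∈ S then f e else 0) =
      fun v => if v ∈ S then bdry src tgt f v else 0 := by
  ext v
  by_cases hv : v ∈ S
  · simp only [bdry, hv, if_true]
    congr 1 <;> refine Finset.sum_congr rfl fun e _ => ?_
    · grind
    · by_cases h0 : f e = 0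
      · simp [h0]
      · have := hf e h0
        grind
  · simp only [bdry, hv, if_false]
    rw [Finset.sum_eq_zero, Finset.sum_eq_zero, sub_zero]
    · intro e _
      by_cases h0 : f e = 0
      · simp [h0]
      · have := hf e h0
        grind
    · intro e _
      grind

end Boundary

section Residual

variable {V E : Type} [Fintype V] [Fintype E] [DecidableEq V] [DecidableEq E] (src tgt : E → V)

/-- The set of vertices reachable from `a` when the edges in `P` may be traversed forwards and
those in `N` backwards, with a unit flow to each of its members. -/
lemma exists_reachable_set (P N : E → Prop) (a : V) :
    ∃ S : Finset V, a ∈ S ∧ (∀ e, P e → src e ∈ S → tgt e ∈ S) ∧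
      (∀ e, N e → tgt e ∈ S → src e ∈ S) ∧
      ∀ u ∈ S, ∃ g : E → ℤ, bdry src tgt g = Pi.single a 1 - Pi.single u 1 ∧
        ∀ e, g e = 0 ∨ (g e = 1 ∧ P e) ∨ (g e = -1 ∧ N e) := by
  let Q : Finset V → Prop := fun S => a ∈ S ∧
    ∀ u ∈ S, ∃ g : E → ℤ, bdry src tgt g = Pi.single a 1 - Pi.single u 1 ∧
        (∀ e, g e = 0 ∨ (g e = 1 ∧ P e) ∨ (g e = -1 ∧ N e)) ∧
        ∀ e, g e ≠ 0 → src e ∈ S ∧ tgt e ∈ S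
  have hQ : Q {a} := by
    refine ⟨by simp, fun u hu => ⟨0, ?_, by simp, by simp⟩⟩
    rw [Finset.mem_singleton.1 hu, bdry_zero, sub_self]
  obtain ⟨S, -, hS⟩ := (Set.toFinite {S | Q S}).exists_le_maximal hQ
  obtain ⟨haS, hg⟩ : Q S := hS.prop
  have extend : ∀ w ∉ S, ¬ ∃ u ∈ S, ∃ e : E, ∃ c : ℤ,
      ((src e = u ∧ tgt e = w ∧ c = 1 ∧ P e) ∨ (src e = w ∧ tgt e = u ∧ c = -1 ∧ N e)) := by
    rintro w hw ⟨u, hu, e, c, he⟩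
    have : Q (insert w S) := by
      refine ⟨by simp [haS], fun z hz => ?_⟩
      rcases Finset.mem_insert.1 hz with rfl | hz
      · obtain ⟨g, hgb, hgv, hgs⟩ := hg u hu
        have hge : g e = 0 := by
          by_contra h
          have := hgs e h
          grind
        refine ⟨g + Pi.single e c, ?_, ?_, ?_⟩
        · rw [bdry_add, bdry_single, hgb]
          rcases he with ⟨rfl, rfl, rfl, -⟩ | ⟨rfl, rfl, rfl, -⟩
          · abel
          · simp only [Pi.single_neg]; abel
        · intro e'
          by_cases h : e' = e
          · subst h; simp [hge]; grind
          · simpa [h] using hgv e'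
        · intro e' he'
          by_cases h : e' = e
          · subst h; grind
          · have := hgs e' (by simpa [h] using he')
            simp [this]
      · obtain ⟨g, hgb, hgv, hgs⟩ := hg z hz
        exact ⟨g, hgb, hgv, fun e he => by simp [hgs e he]⟩
    exact hw (hS.le_of_ge this (Finset.subset_insert w S) (Finset.mem_insert_self w S))
  refine ⟨S, haS, fun e hP hs => ?_, fun e hN ht => ?_, fun u hu => ?_⟩
  · by_contra h
    exact extend _ h ⟨src e, hs, e, 1, Or.inl ⟨rfl, rfl, rfl, hP⟩⟩
  · by_contra h
    exact extend _ h ⟨tgt e, ht, e, -1, Or.inr ⟨rfl, rfl, rfl, hN⟩⟩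
  · obtain ⟨g, h1, h2, -⟩ := hg u hu
    exact ⟨g, h1, h2⟩

/-- An integer function whose boundary vanishes modulo `k` can be changed by multiples of `k`
into an integer `k`-flow. -/
lemma exists_flow_modEq (k : ℕ) (f₀ : E → ℤ) (hk : 0 < k) (hf₀ : ∀ e, |f₀ e| < k)
    (hb : ∀ v, (k : ℤ) ∣ bdry src tgt f₀ v) :
    ∃ f : E → ℤ, bdry src tgt f = 0 ∧ (∀ e, |f e| < k) ∧ ∀ e, (k : ℤ) ∣ f e - f₀ e := by
  induction hn : ∑ v, (bdry src tgt f₀ v).natAbs using Nat.strong_induction_on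
    generalizing f₀ with
  | _ n ih =>
  by_cases h0 : bdry src tgt f₀ = 0
  · exact ⟨f₀, h0, hf₀, by simp⟩
  have htot : ∑ v, bdry src tgt f₀ v = 0 := by
    rw [sum_bdry]; simp
  obtain ⟨a, ha⟩ : ∃ a, 0 < bdry src tgt f₀ a := by
    by_contra! hle
    apply h0
    ext v
    exact (Finset.sum_eq_zero_iff_of_nonpos fun v _ => hle v).1 htot v (Finset.mem_univ v)
  obtain ⟨S, haS, hP, hN, hS⟩ :=
    exists_reachable_set src tgt (fun e => 0 < f₀ e) (fun e => f₀ e < 0) a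
  obtain ⟨b, hbS, hbneg⟩ : ∃ b ∈ S, bdry src tgt f₀ b < 0 := by
    by_contra! hge
    have h1 : ∑ v ∈ S, bdry src tgt f₀ v ≤ 0 := by
      rw [sum_bdry]
      refine Finset.sum_nonpos fun e _ => ?_
      have := hP e
      have := hN e
      grind
    have h2 := Finset.single_le_sum hge haS
    omega
  obtain ⟨g, hgb, hgv⟩ := hS b hbS
  have hab : a ≠ b := by rintro rfl; omega
  have hbdry : ∀ v, bdry src tgt (f₀ - (k : ℤ) • g) v =
      bdry src tgt f₀ v - k * ((Pi.single a 1 - Pi.single b 1 : V → ℤ) v) := by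
    intro v
    rw [bdry_sub, bdry_smul, hgb]; rfl
  obtain ⟨f, hf, hfk, hfm⟩ := ih (∑ v, (bdry src tgt (f₀ - (k : ℤ) • g) v).natAbs) (by
      rw [← hn]
      have hpt : ∀ v, (bdry src tgt (f₀ - (k : ℤ) • g) v).natAbs ≤
          (bdry src tgt f₀ v).natAbs ∧ (v = a → (bdry src tgt (f₀ - (k : ℤ) • g) v).natAbs <
          (bdry src tgt f₀ v).natAbs) := by
        intro v
        rw [hbdry]
        by_cases hva : v = a
        · subst hva
          have := Int.le_of_dvd ha (hb v)
          simp [hab]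
          omega
        · by_cases hvb : v = b
          · subst hvb
            have := Int.le_of_dvd (by omega) ((Int.dvd_neg).2 (hb v))
            simp [hva]
            omega
          · simp [hva, hvb]
      exact Finset.sum_lt_sum (fun v _ => (hpt v).1) ⟨a, Finset.mem_univ a, (hpt a).2 rfl⟩)
    (f₀ - (k : ℤ) • g) (by
      intro e
      have h1 := abs_lt.1 (hf₀ e)
      simp only [Pi.sub_apply, Pi.smul_apply, smul_eq_mul]
      rw [abs_lt]
      rcases hgv e with h | ⟨h, h'⟩ | ⟨h, h'⟩ <;> rw [h] <;> constructor <;> omega)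
    (by
      intro v
      rw [hbdry]
      exact dvd_sub (hb v) (Dvd.intro _ rfl)) rfl
  refine ⟨f, hf, hfk, fun e => ?_⟩
  have h := hfm e
  simp only [Pi.sub_apply, Pi.smul_apply, smul_eq_mul] at h
  have h' := dvd_sub h (Dvd.intro (g e) rfl : (k : ℤ) ∣ k * g e)
  rwa [show f e - (f₀ e - k * g e) - k * g e = f e - f₀ e by ring] at h'

/-- Tutte: a flow with values in `ℤ/k` lifts to an integer `k`-flow. -/
lemma exists_integer_flow_lift (k : ℕ) [NeZero k] (φ : E → ZMod k) (hφ : bdry src tgt φ = 0) :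
    ∃ f : E → ℤ, bdry src tgt f = 0 ∧ (∀ e, |f e| < k) ∧ ∀ e, (f e : ZMod k) = φ e := by
  obtain ⟨f, hf, hfk, hfm⟩ := exists_flow_modEq src tgt k (fun e => ((φ e).val : ℤ))
    (NeZero.pos k) (fun e => by rw [Nat.abs_cast]; exact_mod_cast ZMod.val_lt (φ e)) (fun v => by
      rw [← ZMod.intCast_zmod_eq_zero_iff_dvd]
      have := congrFun (bdry_map src tgt (Int.castAddHom (ZMod k)) fun e => ((φ e).val : ℤ)) v
      simp only [Int.coe_castAddHom, Int.cast_natCast, ZMod.natCast_zmod_val] at this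
      rw [← this]
      exact congrFun hφ v)
  refine ⟨f, hf, hfk, fun e => ?_⟩
  have := (ZMod.intCast_zmod_eq_zero_iff_dvd _ k).2 (hfm e)
  simpa [sub_eq_zero] using this

/-- In a vertex set `W` whose induced subgraph is 2-edge-connected, two units of flow can be
sent between any two vertices through edges of capacity one. -/
lemma exists_two_unit_flow (W : Finset V)
    (hW : ∀ S ⊆ W, S.Nonempty → S ≠ W →
      2 ≤ ((cutset src tgt S).filter fun e => src e ∈ W ∧ tgt e ∈ W).card)
    (x y : V) (hx : x ∈ W) (hy : y ∈ W) :
    ∃ g : E → ℤ, bdry src tgt g = (2 : ℤ) • (Pi.single x 1 - Pi.single y 1) ∧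
      (∀ e, g e ≠ 0 → src e ∈ W ∧ tgt e ∈ W) ∧ ∀ e, g e = 0 ∨ g e = 1 ∨ g e = -1 := by
  have cut : ∀ S : Finset V, x ∈ S → y ∉ S →
      2 ≤ ((cutset src tgt (S ∩ W)).filter fun e => src e ∈ W ∧ tgt e ∈ W).card := by
    intro S hxS hyS
    refine hW _ Finset.inter_subset_right ⟨x, by simp [hxS, hx]⟩ fun h => hyS ?_
    rw [← h] at hy
    exact (Finset.mem_inter.1 hy).1
  have first : ∃ g : E → ℤ, bdry src tgt g = Pi.single x 1 - Pi.single y 1 ∧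
      ∀ e, g e = 0 ∨ (g e = 1 ∧ (src e ∈ W ∧ tgt e ∈ W)) ∨
        (g e = -1 ∧ (src e ∈ W ∧ tgt e ∈ W)) := by
    obtain ⟨S, hxS, hP, hN, hS⟩ := exists_reachable_set src tgt
      (fun e => src e ∈ W ∧ tgt e ∈ W) (fun e => src e ∈ W ∧ tgt e ∈ W) x
    refine hS y ?_
    by_contra hyS
    have h2 := cut S hxS hyS
    rw [Finset.card_eq_zero.2] at h2
    · omega
    · ext e
      have := hP e
      have := hN e
      simp [cutset]
      grind
  obtain ⟨g₁, hg₁, hv₁⟩ := first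
  obtain ⟨S, hxS, hP, hN, hS⟩ := exists_reachable_set src tgt
      (fun e => (src e ∈ W ∧ tgt e ∈ W) ∧ g₁ e ≤ 0)
      (fun e => (src e ∈ W ∧ tgt e ∈ W) ∧ 0 ≤ g₁ e) x
  have hyS : y ∈ S := by
    by_contra hyS
    have h2 := cut S hxS hyS
    have hxy : x ≠ y := by rintro rfl; exact hyS hxS
    have hsum : ∑ v ∈ S, bdry src tgt g₁ v = 1 := by
      rw [hg₁]
      simp [Finset.sum_sub_distrib, Pi.single_apply, hxS, hyS]
    rw [sum_bdry] at hsum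
    have hle : (((cutset src tgt (S ∩ W)).filter fun e => src e ∈ W ∧ tgt e ∈ W).card : ℤ) ≤
        ∑ e, ((if src e ∈ S then g₁ e else 0) - if tgt e ∈ S then g₁ e else 0) := by
      rw [Finset.card_eq_sum_ones, cutset, Finset.filter_filter, Finset.sum_filter]
      push_cast
      refine Finset.sum_le_sum fun e _ => ?_
      have := hP e
      have := hN e
      have := hv₁ e
      simp only [Finset.mem_inter]
      grind
    omega
  obtain ⟨g₂, hg₂, hv₂⟩ := hS y hyS
  refine ⟨g₁ + g₂, ?_, ?_, ?_⟩
  · rw [bdry_add, hg₁, hg₂, two_smul]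
  · intro e he
    have := hv₁ e
    have := hv₂ e
    simp only [Pi.add_apply] at he
    grind
  · intro e
    have := hv₁ e
    have := hv₂ e
    simp only [Pi.add_apply]
    grind

end Residual

section Linked

variable {V E : Type} [Fintype E] [DecidableEq V] (src tgt : E → V)

/-- A unit of `ℤ/3`-flow can be sent from `a` to `b` along edges of `Y`. -/
def Linked (Y : Set E) (a b : V) : Prop :=
  ∃ f : E → ZMod 3, (∀ e ∉ Y, f e = 0) ∧ bdry src tgt f = Pi.single a 1 - Pi.single b 1

/-- The edges with both ends in `U`. -/
def inside (U : Finset V) : Set E := {e | src e ∈ U ∧ tgt e ∈ U}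

variable {src tgt}

lemma Linked.refl (Y : Set E) (a : V) : Linked src tgt Y a a :=
  ⟨0, by simp, by rw [bdry_zero, sub_self]⟩

lemma Linked.symm {Y : Set E} {a b : V} (h : Linked src tgt Y a b) : Linked src tgt Y b a := by
  obtain ⟨f, hf, hb⟩ := h
  exact ⟨-f, fun e he => by simp [hf e he], by rw [bdry_neg, hb, neg_sub]⟩

lemma Linked.trans {Y : Set E} {a b c : V} (h : Linked src tgt Y a b)
    (h' : Linked src tgt Y b c) : Linked src tgt Y a c := by
  obtain ⟨f, hf, hb⟩ := h
  obtain ⟨f', hf', hb'⟩ := h'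
  exact ⟨f + f', fun e he => by simp [hf e he, hf' e he], by rw [bdry_add, hb, hb']; abel⟩

lemma Linked.mono {Y Z : Set E} (hYZ : Y ⊆ Z) {a b : V} (h : Linked src tgt Y a b) :
    Linked src tgt Z a b := by
  obtain ⟨f, hf, hb⟩ := h
  exact ⟨f, fun e he => hf e fun h => he (hYZ h), hb⟩

/-- The unit flow along a single edge, in either direction. -/
lemma exists_edge_unit [DecidableEq E] {e : E} {a b : V}
    (h : (src e = a ∧ tgt e = b) ∨ (src e = b ∧ tgt e = a)) :
    ∃ f : E → ZMod 3, (∀ e', e' ≠ e → f e' = 0) ∧ f e ≠ 0 ∧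
      bdry src tgt f = Pi.single a 1 - Pi.single b 1 := by
  rcases h with ⟨rfl, rfl⟩ | ⟨rfl, rfl⟩
  · exact ⟨Pi.single e 1, fun e' h => by simp [h], by simp, bdry_single src tgt e 1⟩
  · refine ⟨Pi.single e (-1), fun e' h => by simp [h], by simp, ?_⟩
    rw [bdry_single]
    simp only [Pi.single_neg]
    abel

lemma Linked.of_edge [DecidableEq E] {Y : Set E} {e : E} (he : e ∈ Y) {a b : V}
    (h : (src e = a ∧ tgt e = b) ∨ (src e = b ∧ tgt e = a)) : Linked src tgt Y a b := by
  obtain ⟨f, hf, -, hb⟩ := exists_edge_unit h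
  exact ⟨f, fun e' he' => hf e' fun h => he' (h ▸ he), hb⟩

/-- A flow can be changed on `Y ∪ F` to be nonzero on `F` if the ends of each edge of `F` are
linked by `Y`. -/
lemma exists_flow_ne_zero_of_linked [DecidableEq E] (Y : Set E) (F : Finset E)
    (hYF : ∀ e ∈ F, e ∉ Y) (hF : ∀ e ∈ F, Linked src tgt Y (src e) (tgt e))
    (φ : E → ZMod 3) (hφ : bdry src tgt φ = 0) :
    ∃ φ' : E → ZMod 3, bdry src tgt φ' = 0 ∧ (∀ e, e ∉ Y → e ∉ F → φ' e = φ e) ∧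
      ∀ e ∈ F, φ' e ≠ 0 := by
  have hcyc : ∀ e : E, ∃ c : E → ZMod 3, e ∈ F → bdry src tgt c = 0 ∧ c e = 1 ∧
      ∀ e', e' ∉ Y → e' ≠ e → c e' = 0 := by
    intro e
    by_cases he : e ∈ F
    · obtain ⟨f, hf, hb⟩ := hF e he
      refine ⟨Pi.single e 1 - f, fun _ => ⟨?_, ?_, ?_⟩⟩
      · rw [bdry_sub, bdry_single, hb, sub_self]
      · simp [hf e (hYF e he)]
      · intro e' h1 h2
        simp [h2, hf e' h1]
    · exact ⟨0, fun h => absurd h he⟩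
  choose c hc using hcyc
  refine ⟨φ + ∑ e ∈ F, (1 - φ e) • c e, ?_, ?_, ?_⟩
  · rw [bdry_add, hφ, bdry_sum, zero_add]
    refine Finset.sum_eq_zero fun e he => ?_
    rw [bdry_smul, (hc e he).1, smul_zero]
  · intro e hY hF'
    rw [Pi.add_apply, Finset.sum_apply, Finset.sum_eq_zero, add_zero]
    intro g hg
    simp [(hc g hg).2.2 e hY (fun h => hF' (h ▸ hg))]
  · intro e he
    rw [Pi.add_apply, Finset.sum_apply, Finset.sum_eq_single e]
    · simp [(hc e he).2.1]
    · intro g hg hge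
      simp [(hc g hg).2.2 e (hYF e he) hge.symm]
    · exact fun h => absurd he h

/-- Two edges on a common cycle can be made nonzero simultaneously in a `ℤ/3`-flow. -/
lemma exists_shift_ne_zero : ∀ a b p q : ZMod 3, p ≠ 0 → q ≠ 0 →
    ∃ c : ZMod 3, a + c * p ≠ 0 ∧ b + c * q ≠ 0 := by
  decide

end Linked

section SixFlow

variable {V E : Type} [Fintype E] [DecidableEq V] (src tgt : E → V)

/-- The even edge set `C` inside `U` absorbs `U`: every `ℤ/3`-flow can be changed inside `U` to
be nonzero on all edges inside `U` that are not in `C`. -/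
structure FlowAbsorbs (U : Finset V) (C : E → ZMod 2) : Prop where
  even : bdry src tgt C = 0
  supp : ∀ e, C e ≠ 0 → e ∈ inside src tgt U
  linked : ∀ a ∈ U, ∀ b ∈ U, Linked src tgt (inside src tgt U) a b
  fix : ∀ φ : E → ZMod 3, bdry src tgt φ = 0 → ∃ φ' : E → ZMod 3, bdry src tgt φ' = 0 ∧
    (∀ e ∉ inside src tgt U, φ' e = φ e) ∧ ∀ e ∈ inside src tgt U, C e = 0 → φ' e ≠ 0

open Classical in
lemma flowAbsorbs_singleton (v : V) : FlowAbsorbs src tgt {v} 0 where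
  even := bdry_zero src tgt
  supp := by simp
  linked a ha b hb := by
    rw [Finset.mem_singleton.1 ha, Finset.mem_singleton.1 hb]
    exact Linked.refl _ _
  fix φ hφ := by
    obtain ⟨φ', h1, h2, h3⟩ := exists_flow_ne_zero_of_linked (src := src) (tgt := tgt) ∅
      (Finset.univ.filter (· ∈ inside src tgt {v})) (by simp) (by
        intro e he
        simp only [inside, Finset.mem_singleton, Set.mem_ofPred_eq, Finset.mem_filter,
          Finset.mem_univ, true_and] at he
        rw [he.1, he.2]
        exact Linked.refl _ _) φ hφ
    exact ⟨φ', h1, fun e he => h2 e (by simp) (by simpa using he),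
      fun e he _ => h3 e (by simpa using he)⟩

variable [Fintype V]

/-- In a 3-edge-connected graph, outside a proper nonempty vertex set `U` there is a set `W` that
induces a 2-edge-connected subgraph and sends at least two edges to `U`. -/
lemma exists_two_edge_connected_piece (h3 : EdgeConnected src tgt 3) (U : Finset V)
    (hU : U.Nonempty) (hU' : U ≠ Finset.univ) :
    ∃ W : Finset V, Disjoint W U ∧
      (∀ S ⊆ W, S.Nonempty → S ≠ W →
        2 ≤ ((cutset src tgt S).filter fun e => src e ∈ W ∧ tgt e ∈ W).card) ∧
      2 ≤ ((cutset src tgt W).filter fun e => src e ∈ U ∨ tgt e ∈ U).card := by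
  let c : Finset V → ℕ := fun W =>
    ((cutset src tgt W).filter fun e => ¬(src e ∈ U ∨ tgt e ∈ U)).card
  let Q : Finset V → Prop := fun W => W.Nonempty ∧ Disjoint W U ∧ c W ≤ 1
  have hQ : Q Uᶜ := by
    refine ⟨?_, disjoint_compl_left, ?_⟩
    · rwa [Finset.nonempty_iff_ne_empty, Ne, Finset.compl_eq_empty_iff]
    · have : c Uᶜ = 0 := by
        refine Finset.card_eq_zero.2 ?_
        ext e
        simp [cutset]
        tauto
      omega
  obtain ⟨W, -, hW⟩ := (Set.toFinite {W | Q W}).exists_le_minimal hQ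
  obtain ⟨hWne, hWU, hcW⟩ : Q W := hW.prop
  have hmin : ∀ S ⊆ W, S.Nonempty → S ≠ W → 2 ≤ c S := by
    intro S hS hne hSW
    by_contra hlt
    have : Q S := ⟨hne, Finset.disjoint_of_subset_left hS hWU, by omega⟩
    exact hSW (Finset.Subset.antisymm hS (hW.le_of_le this hS))
  refine ⟨W, hWU, fun S hS hne hSW => ?_, ?_⟩
  · have h1 := hmin S hS hne hSW
    have h2 := hmin (W \ S) Finset.sdiff_subset
      (Finset.sdiff_nonempty.2 fun h => hSW (Finset.Subset.antisymm hS h)) (by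
        intro h
        obtain ⟨z, hz⟩ := hne
        have := hS hz
        rw [← h] at this
        exact (Finset.mem_sdiff.1 this).2 hz)
    have h3 : c S + c (W \ S) ≤
        2 * ((cutset src tgt S).filter fun e => src e ∈ W ∧ tgt e ∈ W).card + c W := by
      simp only [c, cutset, Finset.filter_filter, Finset.card_filter, Finset.mul_sum,
        ← Finset.sum_add_distrib]
      refine Finset.sum_le_sum fun e _ => ?_
      have hs := @hS (src e)
      have ht := @hS (tgt e)
      simp only [Finset.mem_sdiff]
      grind
    omega
  · have h1 := h3 W hWne (by
      rintro rfl
      obtain ⟨u, hu⟩ := hU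
      exact Finset.disjoint_left.1 hWU (Finset.mem_univ u) hu)
    have h2 := Finset.card_filter_add_card_filter_not (s := cutset src tgt W)
      (fun e => src e ∈ U ∨ tgt e ∈ U)
    simp only [c] at hcW
    omega

variable [DecidableEq E]

open Classical in
/-- In a 3-edge-connected graph an absorbed proper vertex set can be enlarged. -/
lemma FlowAbsorbs.exists_larger (h3 : EdgeConnected src tgt 3) {U : Finset V} {C : E → ZMod 2}
    (hC : FlowAbsorbs src tgt U C) (hU : U.Nonempty) (hU' : U ≠ Finset.univ) :
    ∃ (U' : Finset V) (C' : E → ZMod 2), U ⊂ U' ∧ FlowAbsorbs src tgt U' C' := by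
  obtain ⟨W, hWU, hW, hcut⟩ := exists_two_edge_connected_piece src tgt h3 U hU hU'
  have hWU' : ∀ {z}, z ∈ W → z ∉ U := fun hz => Finset.disjoint_left.1 hWU hz
  obtain ⟨e₁, he₁, e₂, he₂, hne⟩ := Finset.one_lt_card.1 hcut
  have ends : ∀ e ∈ (cutset src tgt W).filter (fun e => src e ∈ U ∨ tgt e ∈ U),
      ∃ u ∈ U, ∃ x ∈ W, (src e = u ∧ tgt e = x) ∨ (src e = x ∧ tgt e = u) := by
    intro e he
    have h1 := @hWU' (src e)
    have h2 := @hWU' (tgt e)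
    simp only [cutset, Finset.mem_filter, Finset.mem_univ, true_and] at he
    grind
  obtain ⟨u, hu, x, hx, hux⟩ := ends e₁ he₁
  obtain ⟨v, hv, y, hy, hvy⟩ := ends e₂ he₂
  obtain ⟨g, hgb, hgW, hgv⟩ := exists_two_unit_flow src tgt W hW x y hx hy
  let D : Set E := {e | g e ≠ 0}
  let S : Finset V := W.filter (Linked src tgt D x ·)
  have hDS : ∀ e, g e ≠ 0 → (src e ∈ S ↔ tgt e ∈ S) := by
    intro e he
    have hl : Linked src tgt D (src e) (tgt e) := Linked.of_edge he (Or.inl ⟨rfl, rfl⟩)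
    have := hgW e he
    simp only [S, Finset.mem_filter, this, true_and]
    exact ⟨fun h => h.trans hl, fun h => h.trans hl.symm⟩
  have hxS : x ∈ S := Finset.mem_filter.2 ⟨hx, Linked.refl _ _⟩
  have hyS : y ∈ S := by
    refine Finset.mem_filter.2 ⟨hy, fun e => Int.castAddHom (ZMod 3) (((2 : ℤ) • g) e), ?_, ?_⟩
    · intro e he
      have : g e = 0 := by simpa [D] using he
      simp [this]
    · rw [bdry_map, bdry_smul, hgb]
      ext w
      have h4 : ∀ t : ZMod 3, 2 * (2 * t) = t := by decide
      simp [Pi.single_apply, h4, apply_ite (Int.cast : ℤ → ZMod 3)]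
  have hSW : ∀ {z}, z ∈ S → z ∈ W := fun hz => (Finset.mem_filter.1 hz).1
  let D' : Set E := {e | g e ≠ 0 ∧ src e ∈ S}
  have hSlink : ∀ w ∈ S, Linked src tgt D' x w := by
    intro w hw
    obtain ⟨f, hf, hfb⟩ := (Finset.mem_filter.1 hw).2
    refine ⟨fun e => if src e ∈ S then f e else 0, ?_, ?_⟩
    · intro e he
      have h1 := hf e
      simp only [D, D', Set.mem_ofPred_eq] at h1 he
      grind
    · rw [bdry_restrict src tgt S f fun e he => hDS e fun h => he (hf e (by simp [D, h])), hfb]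
      ext z
      by_cases hz : z ∈ S
      · simp [hz]
      · have h1 : z ≠ x := fun h => hz (h ▸ hxS)
        have h2 : z ≠ w := fun h => hz (h ▸ hw)
        simp [hz, h1, h2]
  let d : E → ZMod 2 := fun e => if src e ∈ S then (g e : ZMod 2) else 0
  have hdb : bdry src tgt d = 0 := by
    rw [bdry_restrict src tgt S (fun e => (g e : ZMod 2)) fun e he =>
      hDS e fun h => he (by simp [h])]
    have := bdry_map src tgt (Int.castAddHom (ZMod 2)) g
    simp only [Int.coe_castAddHom] at this
    rw [this, hgb]
    have h2 : ∀ t : ZMod 2, 2 * t = 0 := by decide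
    ext z
    simp [h2]
  have hd0 : ∀ e, e ∉ D' → d e = 0 := by
    intro e he
    simp only [D', Set.mem_ofPred_eq, not_and_or, not_not] at he
    rcases he with he | he <;> simp [d, he]
  have hd1 : ∀ e ∈ D', d e ≠ 0 := by
    rintro e ⟨he, hs⟩
    rcases hgv e with h | h | h
    · exact absurd h he
    · simp [d, hs, h]
    · simp [d, hs, h]
  let U' : Finset V := U ∪ S
  have hUU' : inside src tgt U ⊆ inside src tgt U' := fun e he =>
    ⟨Finset.mem_union_left _ he.1, Finset.mem_union_left _ he.2⟩
  have hD'U' : D' ⊆ inside src tgt U' := fun e he =>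
    ⟨Finset.mem_union_right _ he.2, Finset.mem_union_right _ ((hDS e he.1).1 he.2)⟩
  have hD'U : ∀ e ∈ D', e ∉ inside src tgt U := fun e he h => hWU' (hSW he.2) h.1
  have he₁U' : e₁ ∈ inside src tgt U' := by
    rcases hux with ⟨h1, h2⟩ | ⟨h1, h2⟩ <;> constructor <;> simp [U', h1, h2, hu, hxS]
  have he₂U' : e₂ ∈ inside src tgt U' := by
    rcases hvy with ⟨h1, h2⟩ | ⟨h1, h2⟩ <;> constructor <;> simp [U', h1, h2, hv, hyS]
  have crossing : ∀ e z w, z ∈ U → w ∈ W → (src e = z ∧ tgt e = w) ∨ (src e = w ∧ tgt e = z) →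
      e ∉ inside src tgt U ∧ e ∉ D' := by
    intro e z w hz hw h
    refine ⟨fun hin => ?_, fun hD => ?_⟩
    · have := hWU' hw
      have := hin.1
      have := hin.2
      grind
    · have h1 := hgW e hD.1
      have := hWU' h1.1
      have := hWU' h1.2
      grind
  obtain ⟨he₁U, he₁D⟩ := crossing e₁ u x hu hx hux
  obtain ⟨he₂U, he₂D⟩ := crossing e₂ v y hv hy hvy
  let Y : Set E := inside src tgt U ∪ D' ∪ {e₁}
  have hYU' : Y ⊆ inside src tgt U' :=
    Set.union_subset (Set.union_subset hUU' hD'U') (by simpa using he₁U')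
  have hlinkY : ∀ a ∈ U', Linked src tgt Y u a := by
    intro a ha
    rcases Finset.mem_union.1 ha with ha | ha
    · exact (hC.linked u hu a ha).mono fun e he => Or.inl (Or.inl he)
    · exact (Linked.of_edge (show e₁ ∈ Y from Or.inr rfl) hux).trans
        ((hSlink a ha).mono fun e he => Or.inl (Or.inr he))
  refine ⟨U', C + d, ?_, ?_, ?_, ?_, ?_⟩
  · refine (Finset.ssubset_iff_of_subset Finset.subset_union_left).2
      ⟨x, Finset.mem_union_right _ hxS, hWU' hx⟩
  · rw [bdry_add, hC.even, hdb, add_zero]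
  · intro e he
    by_cases h : e ∈ D'
    · exact hD'U' h
    · refine hUU' (hC.supp e ?_)
      simpa [hd0 e h] using he
  · exact fun a ha b hb => ((hlinkY a ha).symm.trans (hlinkY b hb)).mono hYU'
  · intro φ hφ
    let F : Finset E := Finset.univ.filter fun e => e ∈ inside src tgt U' ∧ e ∉ Y ∧ e ≠ e₂
    have hF : ∀ e ∈ F, e ∈ inside src tgt U' ∧ e ∉ Y ∧ e ≠ e₂ := by simp [F]
    obtain ⟨φ₁, hb₁, hoff₁, hF₁⟩ := exists_flow_ne_zero_of_linked Y F
      (fun e he => (hF e he).2.1)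
      (fun e he => (hlinkY _ (hF e he).1.1).symm.trans (hlinkY _ (hF e he).1.2)) φ hφ
    obtain ⟨p, hp0, hp1, hpb⟩ := exists_edge_unit hux
    obtain ⟨q, hq0, hq1, hqb⟩ := exists_edge_unit hvy
    obtain ⟨l, hl0, hlb⟩ := hSlink y hyS
    obtain ⟨m, hm0, hmb⟩ := hC.linked v hv u hu
    let h : E → ZMod 3 := p + l - q + m
    have hhb : bdry src tgt h = 0 := by
      rw [bdry_add, bdry_sub, bdry_add, hpb, hqb, hlb, hmb]
      abel
    have hh1 : h e₁ ≠ 0 := by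
      simpa [h, hl0 e₁ he₁D, hm0 e₁ he₁U, hq0 e₁ hne] using hp1
    have hh2 : h e₂ ≠ 0 := by
      simpa [h, hl0 e₂ he₂D, hm0 e₂ he₂U, hp0 e₂ hne.symm] using hq1
    have hh0 : ∀ e, e ∉ Y → e ≠ e₂ → h e = 0 := by
      intro e he h2
      simp only [Y, Set.mem_union, Set.mem_singleton_iff, not_or] at he
      simp [h, hl0 e he.1.2, hm0 e he.1.1, hp0 e he.2, hq0 e h2]
    obtain ⟨c, hc1, hc2⟩ := exists_shift_ne_zero (φ₁ e₁) (φ₁ e₂) (h e₁) (h e₂) hh1 hh2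
    obtain ⟨φ₃, hb₃, hoff₃, hU₃⟩ := hC.fix (φ₁ + c • h)
      (by rw [bdry_add, hb₁, bdry_smul, hhb, smul_zero, add_zero])
    refine ⟨φ₃, hb₃, fun e he => ?_, fun e he hCe => ?_⟩
    · have hY : e ∉ Y := fun h => he (hYU' h)
      have h2 : e ≠ e₂ := by rintro rfl; exact he he₂U'
      rw [hoff₃ e fun h => he (hUU' h)]
      simp [hh0 e hY h2, hoff₁ e hY fun h => he (hF e h).1]
    · by_cases hin : e ∈ inside src tgt U
      · refine hU₃ e hin ?_
        simpa [hd0 e fun h => hD'U e h hin] using hCe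
      · rw [hoff₃ e hin]
        have hC0 : C e = 0 := by
          by_contra h
          exact hin (hC.supp e h)
        have hD : e ∉ D' := fun h => hd1 e h (by simpa [hC0] using hCe)
        by_cases h1 : e = e₁
        · subst h1; simpa using hc1
        by_cases h2 : e = e₂
        · subst h2; simpa using hc2
        have hY : e ∉ Y := by simp [Y, hin, hD, h1]
        have := hF₁ e (by simp [F, he, hY, h2])
        simpa [hh0 e hY h2] using this

/-- A graph has a nowhere-zero flow with values in `ℤ/2 × ℤ/3`. -/
def HasSixFlow : Prop :=
  ∃ (C : E → ZMod 2) (φ : E → ZMod 3), bdry src tgt C = 0 ∧ bdry src tgt φ = 0 ∧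
    ∀ e, C e = 0 → φ e ≠ 0

lemma hasSixFlow_of_three_edge_connected (h3 : EdgeConnected src tgt 3) :
    HasSixFlow src tgt := by
  rcases isEmpty_or_nonempty V with hV | ⟨⟨v⟩⟩
  · exact ⟨0, 0, bdry_zero src tgt, bdry_zero src tgt, fun e => isEmptyElim (src e)⟩
  obtain ⟨U, hvU, hU⟩ := (Set.toFinite {U | ∃ C, FlowAbsorbs src tgt U C}).exists_le_maximal
    ⟨0, flowAbsorbs_singleton src tgt v⟩
  obtain ⟨C, hC⟩ := hU.prop
  have huniv : U = Finset.univ := by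
    by_contra hne
    obtain ⟨U', C', hlt, hC'⟩ := hC.exists_larger src tgt h3 ⟨v, hvU (by simp)⟩ hne
    exact hlt.2 (hU.le_of_ge ⟨C', hC'⟩ hlt.1)
  subst huniv
  obtain ⟨φ, hφ, -, hne⟩ := hC.fix 0 (bdry_zero src tgt)
  exact ⟨C, φ, hC.even, hφ, fun e => hne e (by simp [inside])⟩

/-- Lifting a flow through the contraction of the edge `e`, which lies in a two-element cut
together with `e'`. -/
lemma exists_flow_lift_contraction {V' A : Type} [DecidableEq V'] [AddCommGroup A] (π : V → V')
    {e e' : E} (hne : src e ≠ tgt e)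
    (hπ : ∀ v w, π v = π w ↔ v = w ∨ (v = src e ∧ w = tgt e) ∨ (v = tgt e ∧ w = src e))
    {S : Finset V} (hS : cutset src tgt S = {e, e'}) (φ : E → A)
    (hφ : bdry (π ∘ src) (π ∘ tgt) φ = 0) :
    ∃ φ' : E → A, bdry src tgt φ' = 0 ∧ (∀ g, g ≠ e → φ' g = φ g) ∧ (φ' e = 0 → φ' e' = 0) := by
  have hfib : ∀ w, ∑ v with π v = w, bdry src tgt φ v = 0 := by
    intro w
    rw [sum_bdry, Finset.sum_sub_distrib]
    simpa [bdry] using congrFun hφ w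
  have hb : bdry src tgt (φ + Pi.single e (-bdry src tgt φ (src e))) = 0 := by
    ext v
    rw [bdry_add, bdry_single]
    by_cases h1 : v = src e
    · subst h1
      simp [hne]
    by_cases h2 : v = tgt e
    · subst h2
      have hf : (Finset.univ.filter fun v => π v = π (tgt e)) = {src e, tgt e} := by
        ext w
        simp only [Finset.mem_filter, Finset.mem_univ, true_and, Finset.mem_insert,
          Finset.mem_singleton, hπ]
        grind
      have := hfib (π (tgt e))
      rw [hf, Finset.sum_pair hne] at this
      simpa [hne.symm, add_comm] using this
    · have hf : (Finset.univ.filter fun w => π w = π v) = {v} := by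
        ext w
        simp only [Finset.mem_filter, Finset.mem_univ, true_and, Finset.mem_singleton, hπ]
        grind
      have := hfib (π v)
      rw [hf, Finset.sum_singleton] at this
      simpa [h1, h2] using this
  refine ⟨_, hb, fun g hg => by simp [hg], ?_⟩
  generalize φ + Pi.single e (-bdry src tgt φ (src e)) = ψ at hb
  intro h0
  have hmem : ∀ g, ((src g ∈ S ∧ tgt g ∉ S) ∨ (tgt g ∈ S ∧ src g ∉ S)) ↔ g = e ∨ g = e' := by
    intro g
    have : g ∈ cutset src tgt S ↔ g ∈ ({e, e'} : Finset E) := by rw [hS]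
    simpa [cutset] using this
  have hsum := sum_bdry src tgt S ψ
  rw [hb, Finset.sum_eq_single e'] at hsum
  · have := (hmem e').2 (Or.inr rfl)
    simp only [Pi.zero_apply, Finset.sum_const_zero] at hsum
    rcases this with ⟨h1, h2⟩ | ⟨h1, h2⟩ <;> simpa [h1, h2] using hsum.symm
  · intro g _ hg
    by_cases hge : g = e
    · simp [hge, h0]
    · have h1 := hmem g
      have h2 : src g ∈ S ↔ tgt g ∈ S := by tauto
      simp [h2]
  · simp

/-- **Seymour's 6-flow theorem**. -/
theorem hasSixFlow_of_two_edge_connected {V E : Type} [Fintype V] [Fintype E] [DecidableEq V]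
    [DecidableEq E] (src tgt : E → V) (h2 : EdgeConnected src tgt 2) : HasSixFlow src tgt := by
  induction hn : Fintype.card V using Nat.strong_induction_on generalizing V with
  | _ n ih =>
  by_cases h3 : EdgeConnected src tgt 3
  · exact hasSixFlow_of_three_edge_connected src tgt h3
  unfold EdgeConnected at h3
  push Not at h3
  obtain ⟨S, hSne, hSu, hlt⟩ := h3
  obtain ⟨e, e', hee', hS⟩ := Finset.card_eq_two.1 (le_antisymm (by omega) (h2 S hSne hSu))
  have hne : src e ≠ tgt e := by
    have : e ∈ cutset src tgt S := by simp [hS]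
    simp only [cutset, Finset.mem_filter, Finset.mem_univ, true_and] at this
    grind
  let π : V → {v // v ≠ tgt e} := fun v => if h : v = tgt e then ⟨src e, hne⟩ else ⟨v, h⟩
  have hπ : ∀ v w, π v = π w ↔ v = w ∨ (v = src e ∧ w = tgt e) ∨ (v = tgt e ∧ w = src e) := by
    intro v w
    simp only [π]
    grind
  have hsurj : Function.Surjective π := fun v => ⟨v, by simp [π, v.2]⟩
  have hcard : Fintype.card {v // v ≠ tgt e} < n := by
    rw [← hn]
    exact Fintype.card_subtype_lt (x := tgt e) (by simp)
  have hcon : EdgeConnected (π ∘ src) (π ∘ tgt) 2 := by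
    intro T hT hT'
    have hpre : cutset (π ∘ src) (π ∘ tgt) T =
        cutset src tgt (Finset.univ.filter fun v => π v ∈ T) := by
      ext g
      simp [cutset]
    rw [hpre]
    refine h2 _ ?_ fun h => hT' ?_
    · obtain ⟨t, ht⟩ := hT
      obtain ⟨v, rfl⟩ := hsurj t
      exact ⟨v, by simpa using ht⟩
    · ext t
      obtain ⟨v, rfl⟩ := hsurj t
      have : v ∈ Finset.univ.filter fun v => π v ∈ T := by simp [h]
      simpa using this
  obtain ⟨C, φ, hC, hφ, hCφ⟩ := ih _ hcard (π ∘ src) (π ∘ tgt) hcon rfl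
  obtain ⟨C', hC', hCeq, hC0⟩ := exists_flow_lift_contraction src tgt π hne hπ hS C hC
  obtain ⟨φ', hφ', hφeq, hφ0⟩ := exists_flow_lift_contraction src tgt π hne hπ hS φ hφ
  refine ⟨C', φ', hC', hφ', fun g hg hg' => ?_⟩
  have key : ∀ g, g ≠ e → C' g = 0 → φ' g = 0 → False := by
    intro g hge h1 h2
    rw [hCeq g hge] at h1
    rw [hφeq g hge] at h2
    exact hCφ g h1 h2
  by_cases hge : g = e
  · subst hge
    exact key e' hee'.symm (hC0 hg) (hφ0 hg')
  · exact key g hge hg hg'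

end SixFlow

/-- Every 2-edge-connected finite graph (loops and multiple edges allowed) has an integer
3-flow `φ` with `|supp(φ)| ≥ (3/4)|E(G)|`. -/
theorem three_flow_support_two_edge_connected
    (V E : Type) [Fintype V] [Fintype E] [DecidableEq V] [DecidableEq E]
    (src tgt : E → V)
    (h2ec : EdgeConnected src tgt 2) :
    ∃ φ : E → ℤ,
      (∀ v : V, bdry src tgt φ v = 0) ∧
      (∀ e : E, |φ e| ≤ 2) ∧
      3 * Fintype.card E ≤ 4 * (Finset.univ.filter fun e => φ e ≠ 0).card := by
  obtain ⟨C, φ, hC, hφ, hCφ⟩ := hasSixFlow_of_two_edge_connected src tgt h2ec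
  obtain ⟨ψ, hψ, hψ2, hψC⟩ := exists_integer_flow_lift src tgt 2 C hC
  have hψ1 : ∀ e, ψ e = 0 ∨ ψ e = 1 ∨ ψ e = -1 := by
    intro e
    have := abs_lt.1 (hψ2 e)
    push_cast at this
    omega
  by_cases hlarge : 3 * Fintype.card E ≤ 4 * (Finset.univ.filter fun e => ψ e ≠ 0).card
  · refine ⟨ψ, fun v => congrFun hψ v, fun e => ?_, hlarge⟩
    exact (hψ2 e).le
  let χ : ZMod 3 → E → ZMod 3 := fun t => φ + t • fun e => (ψ e : ZMod 3)
  have hχb : ∀ t, bdry src tgt (χ t) = 0 := by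
    intro t
    have := bdry_map src tgt (Int.castAddHom (ZMod 3)) ψ
    simp only [Int.coe_castAddHom] at this
    rw [bdry_add, hφ, bdry_smul, this, hψ]
    ext v
    simp
  have hcount : ∑ t : ZMod 3, (Finset.univ.filter fun e => χ t e = 0).card ≤
      (Finset.univ.filter fun e => ψ e ≠ 0).card := by
    simp only [Finset.card_filter]
    rw [Finset.sum_comm]
    refine Finset.sum_le_sum fun e _ => ?_
    rw [← Finset.card_filter]
    by_cases h0 : ψ e = 0
    · have : φ e ≠ 0 := hCφ e (by rw [← hψC e, h0]; rfl)
      simp [χ, h0, this]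
    · have hu : ∀ a : ZMod 3, (Finset.univ.filter fun t : ZMod 3 => a + t = 0).card ≤ 1 ∧
          (Finset.univ.filter fun t : ZMod 3 => a + -t = 0).card ≤ 1 := by decide
      rcases hψ1 e with h | h | h
      · exact absurd h h0
      · simpa [χ, h] using (hu (φ e)).1
      · simpa [χ, h] using (hu (φ e)).2
  obtain ⟨t, ht⟩ : ∃ t : ZMod 3, 3 * (Finset.univ.filter fun e => χ t e = 0).card ≤
      (Finset.univ.filter fun e => ψ e ≠ 0).card := by
    by_contra! hlt
    have h := Finset.sum_le_sum fun (t : ZMod 3) (_ : t ∈ Finset.univ) => Nat.succ_le_of_lt (hlt t)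
    simp only [Finset.sum_const, Finset.card_univ, ZMod.card, ← Finset.mul_sum, smul_eq_mul] at h
    omega
  obtain ⟨f, hf, hf3, hfχ⟩ := exists_integer_flow_lift src tgt 3 (χ t) (hχb t)
  refine ⟨f, fun v => congrFun hf v, fun e => ?_, ?_⟩
  · have := hf3 e
    push_cast at this
    omega
  · have hzero : (Finset.univ.filter fun e => f e = 0).card ≤
        (Finset.univ.filter fun e => χ t e = 0).card := by
      refine Finset.card_le_card fun e he => ?_
      simp only [Finset.mem_filter, Finset.mem_univ, true_and] at he ⊢
      rw [← hfχ e, he, Int.cast_zero]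
    have hsplit := Finset.card_filter_add_card_filter_not (s := (Finset.univ : Finset E))
      (fun e => f e = 0)
    rw [Finset.card_univ] at hsplit
    simp only [ne_eq] at *
    omega
end

section
/- Let G be a 2-edge-connected cubic finite graph and let w: E(G) → [0, ∞) be a weighting of the edges. Then G contains two perfect matchings M_1 and M_2 such that w(M_1 ∩ M_2) ≤ w(E(G))/15. -/
open Finset

/-- `M` is a perfect matching: every vertex is an endpoint of exactly one edge of `M`
(a loop at `v` would count twice at `v`, so loops never occur in a perfect matching). -/
def IsPerfectMatching {V E : Type} [DecidableEq V] (src tgt : E → V) (M : Finset E) : Prop :=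
  ∀ v : V, (M.filter fun e => src e = v).card + (M.filter fun e => tgt e = v).card = 1

section SupportGraph

variable {V E : Type}

/-- The simple graph of the edges of positive value. -/
def supportGraph (src tgt : E → V) (x : E → ℝ) : SimpleGraph V :=
  SimpleGraph.fromRel fun u v => ∃ e, 0 < x e ∧ src e = u ∧ tgt e = v

lemma supportGraph_adj {src tgt : E → V} {x : E → ℝ} {u v : V} :
    (supportGraph src tgt x).Adj u v ↔ u ≠ v ∧ ∃ e, 0 < x e ∧ s(src e, tgt e) = s(u, v) := by
  simp only [supportGraph, SimpleGraph.fromRel_adj, Sym2.eq_iff, ← exists_or]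
  refine and_congr_right fun _ => exists_congr fun e => ?_
  tauto

end SupportGraph

section FractionalMatching

variable {V E : Type} [Fintype E] [DecidableEq V]

lemma mem_cutset {src tgt : E → V} {S : Finset V} {e : E} :
    e ∈ cutset src tgt S ↔ ¬ (src e ∈ S ↔ tgt e ∈ S) := by
  simp only [cutset, mem_filter, mem_univ, true_and]
  tauto

lemma cutset_compl [Fintype V] (src tgt : E → V) (S : Finset V) :
    cutset src tgt Sᶜ = cutset src tgt S := by
  ext e
  simp only [mem_cutset, mem_compl]
  tauto

/-- A point of the perfect matching polytope scaled by `r`: nonnegative, zero on loops, of total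
value `r` at every vertex and at least `r` across every cut of an odd vertex set. -/
structure IsFracMatching (src tgt : E → V) (r : ℝ) (x : E → ℝ) : Prop where
  nonneg : ∀ e, 0 ≤ x e
  loop : ∀ e, src e = tgt e → x e = 0
  deg : ∀ v, ∑ e ∈ cutset src tgt {v}, x e = r
  odd : ∀ S : Finset V, Odd S.card → r ≤ ∑ e ∈ cutset src tgt S, x e

lemma IsFracMatching.even_card [Fintype V] {src tgt : E → V} {r : ℝ} {x : E → ℝ} (hr : 0 < r)
    (hx : IsFracMatching src tgt r x) : Even (Fintype.card V) := by
  by_contra h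
  have := hx.odd univ (by simpa using h)
  simp [cutset] at this
  linarith

lemma IsFracMatching.map [Fintype V] {V' : Type} [Fintype V'] [DecidableEq V'] {src tgt : E → V}
    {r : ℝ} {x : E → ℝ} (hx : IsFracMatching src tgt r x) (φ : V → V')
    (hodd : ∀ v', Odd (univ.filter (φ · = v')).card)
    (htight : ∀ v', ∑ e ∈ cutset src tgt (univ.filter (φ · = v')), x e = r) :
    IsFracMatching (φ ∘ src) (φ ∘ tgt) r
      (fun e => if φ (src e) = φ (tgt e) then 0 else x e) := by
  have hcut : ∀ S : Finset V', ∑ e ∈ cutset (φ ∘ src) (φ ∘ tgt) S,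
      (if φ (src e) = φ (tgt e) then 0 else x e) =
      ∑ e ∈ cutset src tgt (univ.filter (φ · ∈ S)), x e := by
    intro S
    have : cutset (φ ∘ src) (φ ∘ tgt) S = cutset src tgt (univ.filter (φ · ∈ S)) := by
      ext e; simp [mem_cutset]
    rw [← this]
    refine Finset.sum_congr rfl fun e he => if_neg fun h => ?_
    simp [mem_cutset, h] at he
  refine ⟨fun e => ?_, fun e he => if_pos he, fun v => ?_, fun S hS => ?_⟩
  · split_ifs
    exacts [le_rfl, hx.nonneg e]
  · rw [hcut]
    simpa using htight v
  · rw [hcut]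
    apply hx.odd
    have : (univ.filter (φ · ∈ S)).card = ∑ v' ∈ S, (univ.filter (φ · = v')).card := by
      rw [Finset.card_eq_sum_card_fiberwise (f := φ) (t := S) (fun v hv => by simpa using hv)]
      refine Finset.sum_congr rfl fun v' hv' => congrArg card ?_
      ext v
      simp only [mem_filter, mem_univ, true_and, and_iff_right_iff_imp]
      rintro rfl
      exact hv'
    rw [this, Finset.odd_sum_iff_odd_card_odd, Finset.filter_true_of_mem fun v _ => hodd v]
    exact hS

variable [DecidableEq E]

lemma card_inter_cutset_mod_two (src tgt : E → V) (M : Finset E) (S : Finset V) :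
    ((M ∩ cutset src tgt S).card : ZMod 2) =
      ∑ v ∈ S, ((M ∩ cutset src tgt {v}).card : ZMod 2) := by
  have key : ∀ T : Finset V, ((M ∩ cutset src tgt T).card : ZMod 2) =
      ∑ e ∈ M, ((if src e ∈ T then 1 else 0) + (if tgt e ∈ T then 1 else 0)) := by
    intro T
    rw [← Finset.filter_mem_eq_inter, Finset.card_filter]
    push_cast
    refine Finset.sum_congr rfl fun e _ => ?_
    simp only [mem_cutset]
    by_cases h1 : src e ∈ T <;> by_cases h2 : tgt e ∈ T <;> simp [h1, h2]
    decide
  simp only [key]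
  rw [Finset.sum_comm]
  refine Finset.sum_congr rfl fun e _ => ?_
  simp [Finset.sum_add_distrib]

lemma odd_card_inter_cutset {src tgt : E → V} {M : Finset E} {S : Finset V}
    (hM : ∀ v, Odd (M ∩ cutset src tgt {v}).card) (hS : Odd S.card) :
    Odd (M ∩ cutset src tgt S).card := by
  have h := card_inter_cutset_mod_two src tgt M S
  rw [Finset.sum_congr rfl fun v _ => ZMod.natCast_eq_one_iff_odd.2 (hM v)] at h
  rw [← ZMod.natCast_eq_one_iff_odd, h]
  simpa using ZMod.natCast_eq_one_iff_odd.2 hS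

variable [Fintype V]

/-- Every scaled point of the perfect matching polytope over `V` and `E` is matched or beaten, for
every weighting, by a perfect matching inside its support. -/
def MatchingBound (V E : Type) [Fintype V] [Fintype E] [DecidableEq V] [DecidableEq E] : Prop :=
  ∀ (src tgt : E → V) (r : ℝ) (x w : E → ℝ), 0 < r → IsFracMatching src tgt r x →
    ∃ M : Finset E, (∀ v, (M ∩ cutset src tgt {v}).card = 1) ∧ (∀ e ∈ M, 0 < x e) ∧
      r * ∑ e ∈ M, w e ≤ ∑ e, w e * x e

/-- A perfect matching, inside the support of `x`, of the graph obtained by contracting the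
complement of `S` to one vertex. -/
structure IsSideMatching (src tgt : E → V) (x : E → ℝ) (S : Finset V) (N : Finset E) : Prop where
  pos : ∀ f ∈ N, 0 < x f
  touch : ∀ f ∈ N, src f ∈ S ∨ tgt f ∈ S
  deg : ∀ v ∈ S, (N ∩ cutset src tgt {v}).card = 1
  cut : (N ∩ cutset src tgt S).card = 1

lemma exists_sideMatching {src tgt : E → V} {r : ℝ} {x : E → ℝ} (hr : 0 < r)
    (hx : IsFracMatching src tgt r x) {S : Finset V} (hS : Odd Sᶜ.card)
    (htight : ∑ e ∈ cutset src tgt S, x e = r) (ih : MatchingBound (Option S) E) (w : E → ℝ) :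
    ∃ N, IsSideMatching src tgt x S N ∧
      r * ∑ e ∈ N, w e ≤ ∑ e, w e * if src e ∈ S ∨ tgt e ∈ S then x e else 0 := by
  let φ : V → Option S := fun v => if h : v ∈ S then some ⟨v, h⟩ else none
  have hφS : ∀ v (h : v ∈ S), φ v = some ⟨v, h⟩ := fun v h => dif_pos h
  have hφn : ∀ v, v ∉ S → φ v = none := fun v h => dif_neg h
  have hnone : univ.filter (φ · = none) = Sᶜ := by
    ext v
    by_cases h : v ∈ S <;> simp [h, hφS, hφn]
  have hsome : ∀ u : S, univ.filter (φ · = some u) = {u.1} := by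
    rintro ⟨u, hu⟩
    ext v
    by_cases h : v ∈ S
    · simp [h, hφS]
    · simp only [mem_filter, mem_univ, hφn v h, mem_singleton, true_and, reduceCtorEq, false_iff]
      rintro rfl
      exact h hu
  have hcut : ∀ T, cutset (φ ∘ src) (φ ∘ tgt) T = cutset src tgt (univ.filter (φ · ∈ T)) := by
    intro T
    ext e
    simp [mem_cutset]
  obtain ⟨N, hdeg, hpos, hle⟩ := ih _ _ r _ w hr (hx.map φ
    (by rintro (_ | u); exacts [hnone ▸ hS, by simp [hsome]])
    (by
      rintro (_ | u)
      · rw [hnone, cutset_compl, htight]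
      · rw [hsome, hx.deg]))
  have hval : ∀ e, (if φ (src e) = φ (tgt e) then 0 else x e) =
      if src e ∈ S ∨ tgt e ∈ S then x e else 0 := by
    intro e
    by_cases h1 : src e ∈ S <;> by_cases h2 : tgt e ∈ S <;> simp [h1, h2, hφS, hφn]
    intro h
    exact (hx.loop e h).symm
  simp only [hval] at hpos hle
  refine ⟨N, ⟨fun f hf => ?_, fun f hf => ?_, fun v hv => ?_, ?_⟩, hle⟩
  · have := hpos f hf
    split_ifs at this
    exacts [this, (lt_irrefl _ this).elim]
  · by_contra h
    have := hpos f hf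
    rw [if_neg h] at this
    exact lt_irrefl _ this
  · have := hdeg (some ⟨v, hv⟩)
    simpa only [hcut, mem_singleton, hsome] using this
  · have := hdeg none
    simpa only [hcut, mem_singleton, hnone, cutset_compl] using this

/-- For every edge `e` across a tight cut there is a side matching through `e`, so that on average
these matchings do not outweigh `x` inside `S`. -/
lemma exists_sideMatching_family {src tgt : E → V} {r : ℝ} {x : E → ℝ} (hr : 0 < r)
    (hx : IsFracMatching src tgt r x) {S : Finset V} (hS : Odd Sᶜ.card)
    (htight : ∑ e ∈ cutset src tgt S, x e = r) (ih : MatchingBound (Option S) E) (w : E → ℝ) :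
    ∃ g : E → Finset E,
      (∀ e ∈ cutset src tgt S, 0 < x e → IsSideMatching src tgt x S (g e) ∧ e ∈ g e) ∧
      ∑ e ∈ cutset src tgt S, x e * ∑ f ∈ g e with src f ∈ S ∧ tgt f ∈ S, w f ≤
        ∑ f with src f ∈ S ∧ tgt f ∈ S, w f * x f := by
  have hmin : ∀ e, ∃ N, e ∈ cutset src tgt S → 0 < x e →
      (IsSideMatching src tgt x S N ∧ e ∈ N) ∧ ∀ N', IsSideMatching src tgt x S N' ∧ e ∈ N' →
        ∑ f ∈ N with src f ∈ S ∧ tgt f ∈ S, w f ≤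
          ∑ f ∈ N' with src f ∈ S ∧ tgt f ∈ S, w f := by
    intro e
    by_cases he : e ∈ cutset src tgt S ∧ 0 < x e
    · obtain ⟨N₀, hN₀, hle⟩ := exists_sideMatching hr hx hS htight ih
        (fun f => if f = e then -1 else 0)
      have heN : e ∈ N₀ := by
        by_contra h
        have ht : src e ∈ S ∨ tgt e ∈ S := by
          have := mem_cutset.1 he.1
          tauto
        simp only [Finset.sum_ite_eq', h, if_false, mul_zero, ite_mul, zero_mul, mem_univ,
          if_true, if_pos ht] at hle
        linarith [he.2]
      classical
      obtain ⟨N, hN, hmin⟩ := Finset.exists_min_image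
        (univ.filter fun N => IsSideMatching src tgt x S N ∧ e ∈ N)
        (fun N => ∑ f ∈ N with src f ∈ S ∧ tgt f ∈ S, w f) ⟨N₀, by simp [hN₀, heN]⟩
      simp only [mem_filter, mem_univ, true_and] at hN hmin
      exact ⟨N, fun _ _ => ⟨hN, hmin⟩⟩
    · exact ⟨∅, fun h1 h2 => (he ⟨h1, h2⟩).elim⟩
  choose g hg using hmin
  refine ⟨g, fun e he hpos => (hg e he hpos).1, ?_⟩
  set c : E → ℝ := fun e => ∑ f ∈ g e with src f ∈ S ∧ tgt f ∈ S, w f with hc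
  obtain ⟨N, hN, hle⟩ := exists_sideMatching hr hx hS htight ih
    (fun e => (if src e ∈ S ∧ tgt e ∈ S then w e else 0) -
      if e ∈ cutset src tgt S then c e else 0)
  obtain ⟨e, he⟩ := Finset.card_eq_one.1 hN.cut
  have heN : e ∈ N ∩ cutset src tgt S := by simp [he]
  rw [mem_inter] at heN
  have hmin := (hg e heN.2 (hN.pos e heN.1)).2 N ⟨hN, heN.1⟩
  have hl : ∑ f ∈ N, ((if src f ∈ S ∧ tgt f ∈ S then w f else 0) -
      if f ∈ cutset src tgt S then c f else 0) =
      ∑ f ∈ N with src f ∈ S ∧ tgt f ∈ S, w f - c e := by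
    rw [Finset.sum_sub_distrib, ← Finset.sum_filter, ← Finset.sum_filter,
      Finset.filter_mem_eq_inter, he, Finset.sum_singleton]
  have hrr : ∑ f, ((if src f ∈ S ∧ tgt f ∈ S then w f else 0) -
      if f ∈ cutset src tgt S then c f else 0) * (if src f ∈ S ∨ tgt f ∈ S then x f else 0) =
      ∑ f with src f ∈ S ∧ tgt f ∈ S, w f * x f - ∑ f ∈ cutset src tgt S, x f * c f := by
    have : cutset src tgt S = univ.filter (· ∈ cutset src tgt S) := by simp
    rw [this, Finset.sum_filter, Finset.sum_filter, ← Finset.sum_sub_distrib]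
    refine Finset.sum_congr rfl fun f _ => ?_
    simp only [mem_filter, mem_univ, true_and, mem_cutset]
    by_cases h1 : src f ∈ S <;> by_cases h2 : tgt f ∈ S <;> simp [h1, h2, mul_comm]
  rw [hl, hrr] at hle
  have : 0 ≤ r * (∑ f ∈ N with src f ∈ S ∧ tgt f ∈ S, w f - c e) :=
    mul_nonneg hr.le (sub_nonneg.2 hmin)
  linarith

lemma exists_matching_of_tight_cut {src tgt : E → V} {r : ℝ} {x : E → ℝ} (hr : 0 < r)
    (hx : IsFracMatching src tgt r x) {S : Finset V} (hS : Odd S.card) (hS' : Odd Sᶜ.card)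
    (htight : ∑ e ∈ cutset src tgt S, x e = r) (ih : MatchingBound (Option S) E)
    (ih' : MatchingBound (Option (Sᶜ : Finset V)) E) (w : E → ℝ) :
    ∃ M : Finset E, (∀ v, (M ∩ cutset src tgt {v}).card = 1) ∧ (∀ e ∈ M, 0 < x e) ∧
      r * ∑ e ∈ M, w e ≤ ∑ e, w e * x e := by
  obtain ⟨g, hg, hgw⟩ := exists_sideMatching_family hr hx hS' htight ih w
  obtain ⟨g', hg', hgw'⟩ := exists_sideMatching_family hr hx (S := Sᶜ) (by rwa [compl_compl])
    (by rwa [cutset_compl]) ih' w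
  rw [cutset_compl] at hg' hgw'
  simp only [mem_compl] at hgw'
  set b : E → ℝ := fun e => ∑ f ∈ g e with src f ∈ S ∧ tgt f ∈ S, w f with hb
  set b' : E → ℝ := fun e => ∑ f ∈ g' e with src f ∉ S ∧ tgt f ∉ S, w f with hb'
  set c := ∑ e, w e * x e with hc
  have hsplit : c = ∑ f with src f ∈ S ∧ tgt f ∈ S, w f * x f +
      ∑ f with src f ∉ S ∧ tgt f ∉ S, w f * x f + ∑ e ∈ cutset src tgt S, w e * x e := by
    have : cutset src tgt S = univ.filter (· ∈ cutset src tgt S) := by simp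
    rw [hc, this, Finset.sum_filter, Finset.sum_filter, Finset.sum_filter,
      ← Finset.sum_add_distrib, ← Finset.sum_add_distrib]
    refine Finset.sum_congr rfl fun f _ => ?_
    simp only [mem_cutset]
    by_cases h1 : src f ∈ S <;> by_cases h2 : tgt f ∈ S <;> simp [h1, h2]
  obtain ⟨e, he, hpos, hle⟩ : ∃ e ∈ cutset src tgt S, 0 < x e ∧ r * (b e + b' e + w e) ≤ c := by
    by_contra! hcon
    have hlt : ∑ e ∈ cutset src tgt S, x e * c <
        ∑ e ∈ cutset src tgt S, x e * (r * (b e + b' e + w e)) := by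
      apply Finset.sum_lt_sum
      · intro e he
        rcases (hx.nonneg e).eq_or_lt with h | h
        · simp [← h]
        · exact (mul_lt_mul_of_pos_left (hcon e he h) h).le
      · obtain ⟨e, he, h⟩ : ∃ e ∈ cutset src tgt S, 0 < x e :=
          Finset.exists_lt_of_sum_lt (by simpa [htight] using hr)
        exact ⟨e, he, mul_lt_mul_of_pos_left (hcon e he h) h⟩
    rw [← Finset.sum_mul, htight] at hlt
    have h2 : ∑ e ∈ cutset src tgt S, x e * (r * (b e + b' e + w e)) =
        r * (∑ e ∈ cutset src tgt S, x e * b e + ∑ e ∈ cutset src tgt S, x e * b' e +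
          ∑ e ∈ cutset src tgt S, w e * x e) := by
      rw [← Finset.sum_add_distrib, ← Finset.sum_add_distrib, Finset.mul_sum]
      exact Finset.sum_congr rfl fun e _ => by ring
    rw [h2] at hlt
    have := lt_of_mul_lt_mul_left hlt hr.le
    linarith
  obtain ⟨hN, heN⟩ := hg e he hpos
  obtain ⟨hN', heN'⟩ := hg' e he hpos
  have hcut : ∀ f ∈ g e, f ∈ cutset src tgt S → f = e := fun f hf hfc =>
    Finset.card_le_one.1 hN.cut.le f (mem_inter.2 ⟨hf, hfc⟩) e (mem_inter.2 ⟨heN, he⟩)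
  have hcut' : ∀ f ∈ g' e, f ∈ cutset src tgt S → f = e := fun f hf hfc =>
    Finset.card_le_one.1 hN'.cut.le f (mem_inter.2 ⟨hf, by rwa [cutset_compl]⟩) e
      (mem_inter.2 ⟨heN', by rwa [cutset_compl]⟩)
  have htouch : ∀ f ∈ g e, f ≠ e → src f ∈ S ∧ tgt f ∈ S := by
    intro f hf hne
    have h1 := hN.touch f hf
    have h2 := mt (hcut f hf) hne
    rw [mem_cutset] at h2
    tauto
  have htouch' : ∀ f ∈ g' e, f ≠ e → src f ∉ S ∧ tgt f ∉ S := by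
    intro f hf hne
    have h1 := hN'.touch f hf
    have h2 := mt (hcut' f hf) hne
    rw [mem_cutset] at h2
    simp only [mem_compl] at h1
    tauto
  have hends := mem_cutset.1 he
  refine ⟨g e ∪ g' e, fun v => ?_, fun f hf => ?_, ?_⟩
  · by_cases hv : v ∈ S
    · rw [← hN.deg v hv]
      congr 1
      ext f
      simp only [mem_inter, mem_union, and_congr_left_iff, or_iff_left_iff_imp]
      intro hfv hf
      by_contra hfe
      have hne : f ≠ e := fun h => hfe (h ▸ heN)
      have := htouch' f hf hne
      simp only [mem_cutset, mem_singleton] at hfv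
      grind
    · rw [← hN'.deg v (mem_compl.2 hv)]
      congr 1
      ext f
      simp only [mem_inter, mem_union, and_congr_left_iff, or_iff_right_iff_imp]
      intro hfv hf
      by_contra hfe
      have hne : f ≠ e := fun h => hfe (h ▸ heN')
      have := htouch f hf hne
      simp only [mem_cutset, mem_singleton] at hfv
      grind
  · rcases mem_union.1 hf with h | h
    exacts [hN.pos f h, hN'.pos f h]
  · have hM : g e ∪ g' e = insert e ((g e).filter (fun f => src f ∈ S ∧ tgt f ∈ S) ∪
        (g' e).filter (fun f => src f ∉ S ∧ tgt f ∉ S)) := by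
      ext f
      simp only [mem_union, mem_insert, mem_filter]
      by_cases hfe : f = e
      · simp [hfe, heN]
      · have h1 := htouch f
        have h2 := htouch' f
        tauto
    rw [hM, Finset.sum_insert (by simp only [mem_union, mem_filter]; tauto),
      Finset.sum_union (Finset.disjoint_left.2 fun f h1 h2 =>
        (mem_filter.1 h2).2.1 (mem_filter.1 h1).2.1)]
    calc _ = r * (b e + b' e + w e) := by ring
      _ ≤ c := hle

lemma exists_matching_of_supportGraph {src tgt : E → V} {x : E → ℝ}
    {H : (supportGraph src tgt x).Subgraph} (hH : H.IsPerfectMatching) :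
    ∃ M : Finset E, (∀ v, (M ∩ cutset src tgt {v}).card = 1) ∧ ∀ e ∈ M, 0 < x e := by
  rw [SimpleGraph.Subgraph.isPerfectMatching_iff] at hH
  choose p hp huniq using hH
  have hedge : ∀ s : Sym2 V, s ∈ H.edgeSet → ∃ e, 0 < x e ∧ s(src e, tgt e) = s := by
    intro s
    induction s with | _ u v
    intro h
    exact (supportGraph_adj.1 (H.adj_sub h)).2
  choose rep hpos hrep using hedge
  have hcongr : ∀ s t (hs : s ∈ H.edgeSet) (ht : t ∈ H.edgeSet), s = t → rep s hs = rep t ht := by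
    rintro s _ _ _ rfl
    rfl
  refine ⟨univ.image fun v => rep s(v, p v) (hp v), fun v => ?_, fun e he => ?_⟩
  · rw [Finset.card_eq_one]
    refine ⟨rep s(v, p v) (hp v), ?_⟩
    ext e
    simp only [mem_inter, mem_image, mem_univ, true_and, mem_singleton, mem_cutset]
    constructor
    · rintro ⟨⟨u, rfl⟩, hu⟩
      have h := hrep s(u, p u) (hp u)
      have huv : v = u ∨ v = p u := by
        rw [Sym2.eq_iff] at h
        grind
      rcases huv with rfl | rfl
      · rfl
      · exact hcongr _ _ _ _ (by rw [← huniq (p u) u (hp u).symm, Sym2.eq_swap])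
    · rintro rfl
      refine ⟨⟨v, rfl⟩, ?_⟩
      have h := hrep s(v, p v) (hp v)
      have hne := (H.adj_sub (hp v)).ne
      rw [Sym2.eq_iff] at h
      grind
  · simp only [mem_image, mem_univ, true_and] at he
    obtain ⟨v, rfl⟩ := he
    exact hpos _ _

lemma IsFracMatching.not_isTutteViolator {src tgt : E → V} {r : ℝ} {x : E → ℝ} (hr : 0 < r)
    (hx : IsFracMatching src tgt r x) (T : Set V) :
    ¬ (supportGraph src tgt x).IsTutteViolator T := by
  classical
  set K := ((⊤ : (supportGraph src tgt x).Subgraph).deleteVerts T).coe with hK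
  rw [SimpleGraph.IsTutteViolator, not_lt, ← hK]
  have hverts : ∀ v, v ∈ ((⊤ : (supportGraph src tgt x).Subgraph).deleteVerts T).verts ↔ v ∉ T := by
    simp
  let S : K.ConnectedComponent → Finset V := fun c =>
    univ.filter fun v => ∃ h : v ∉ T, K.connectedComponentMk ⟨v, (hverts v).2 h⟩ = c
  have hSodd : ∀ c ∈ K.oddComponents, Odd (S c).card := by
    intro c hc
    have : (S c : Set V) = Subtype.val '' c.supp := by
      ext v
      simp [S, SimpleGraph.ConnectedComponent.mem_supp_iff]
    rw [← Set.ncard_coe_finset, this, Set.ncard_image_of_injective _ Subtype.val_injective]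
    exact hc
  have hcross : ∀ c e, 0 < x e → e ∈ cutset src tgt (S c) →
      ∃ a b, s(src e, tgt e) = s(a, b) ∧ a ∈ S c ∧ b ∈ T := by
    intro c e he hc
    have key : ∀ a b, s(src e, tgt e) = s(a, b) → a ∈ S c → b ∉ S c → b ∈ T := by
      intro a b hab ha hb
      by_contra hbT
      simp only [S, mem_filter, mem_univ, true_and] at ha hb
      obtain ⟨haT, rfl⟩ := ha
      refine hb ⟨hbT, SimpleGraph.ConnectedComponent.sound (SimpleGraph.Adj.reachable ?_)⟩
      have hne : a ≠ b := by
        rintro rfl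
        exact hb ⟨hbT, rfl⟩
      have hadj : (supportGraph src tgt x).Adj b a :=
        (supportGraph_adj.2 ⟨hne, e, he, hab⟩).symm
      simp [hK, hadj, haT, hbT]
    by_cases h : src e ∈ S c
    · exact ⟨src e, tgt e, rfl, h, key _ _ rfl h (by have := mem_cutset.1 hc; tauto)⟩
    · have h' : tgt e ∈ S c := by have := mem_cutset.1 hc; tauto
      exact ⟨tgt e, src e, Sym2.eq_swap, h', key _ _ Sym2.eq_swap h' h⟩
  have hmain : ∑ c ∈ K.oddComponents.toFinset, ∑ e ∈ cutset src tgt (S c), x e ≤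
      ∑ t ∈ T.toFinset, ∑ e ∈ cutset src tgt {t}, x e := by
    have hite : ∀ U, ∑ e ∈ cutset src tgt U, x e =
        ∑ e, if e ∈ cutset src tgt U then x e else 0 := by
      intro U
      rw [← Finset.sum_filter]
      simp
    simp only [hite]
    rw [Finset.sum_comm, Finset.sum_comm (s := T.toFinset)]
    refine Finset.sum_le_sum fun e _ => ?_
    have hnn : ∀ t ∈ T.toFinset, 0 ≤ if e ∈ cutset src tgt {t} then x e else 0 := by
      intro t _
      split_ifs
      exacts [hx.nonneg e, le_rfl]
    by_cases hex : 0 < x e ∧ ∃ c, e ∈ cutset src tgt (S c)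
    · obtain ⟨he, c, hc⟩ := hex
      obtain ⟨a, b, hab, ha, hb⟩ := hcross c e he hc
      have haT : a ∉ T := (mem_filter.1 ha).2.1
      have huniq : ∀ d, d ≠ c → e ∉ cutset src tgt (S d) := by
        intro d hd hed
        obtain ⟨a', b', hab', ha', hb'⟩ := hcross d e he hed
        have ha'T : a' ∉ T := (mem_filter.1 ha').2.1
        have haa : a = a' := by
          rw [hab, Sym2.eq_iff] at hab'
          grind
        subst haa
        obtain ⟨_, h1⟩ := (mem_filter.1 ha).2
        obtain ⟨_, h2⟩ := (mem_filter.1 ha').2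
        exact hd (h2.symm.trans h1)
      have heb : e ∈ cutset src tgt {b} := by
        have : a ≠ b := fun h => haT (h ▸ hb)
        simp only [mem_cutset, mem_singleton]
        rw [Sym2.eq_iff] at hab
        grind
      calc _ ≤ x e := by
            rw [← Finset.sum_filter]
            calc _ ≤ ∑ d ∈ {c}, x e := by
                  apply Finset.sum_le_sum_of_subset_of_nonneg
                  · intro d hd
                    by_contra h
                    exact huniq d (by simpa using h) (mem_filter.1 hd).2
                  · exact fun _ _ _ => he.le
              _ = x e := by simp
        _ = if e ∈ cutset src tgt {b} then x e else 0 := (if_pos heb).symm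
        _ ≤ _ := Finset.single_le_sum hnn (by simpa using hb)
    · refine le_trans (Finset.sum_nonpos fun c _ => ?_) (Finset.sum_nonneg hnn)
      split_ifs with h
      · exact not_lt.1 fun he => hex ⟨he, c, h⟩
      · exact le_rfl
  have hlow : (K.oddComponents.ncard : ℝ) * r ≤
      ∑ c ∈ K.oddComponents.toFinset, ∑ e ∈ cutset src tgt (S c), x e := by
    rw [Set.ncard_eq_toFinset_card', ← nsmul_eq_mul]
    exact Finset.card_nsmul_le_sum _ _ _ fun c hc => hx.odd _ (hSodd c (Set.mem_toFinset.1 hc))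
  have hup : ∑ t ∈ T.toFinset, ∑ e ∈ cutset src tgt {t}, x e = (T.ncard : ℝ) * r := by
    simp [hx.deg, Set.ncard_eq_toFinset_card']
  have := le_of_mul_le_mul_right (hlow.trans (hmain.trans hup.le)) hr
  exact_mod_cast this

lemma IsFracMatching.exists_matching {src tgt : E → V} {r : ℝ} {x : E → ℝ} (hr : 0 < r)
    (hx : IsFracMatching src tgt r x) :
    ∃ M : Finset E, (∀ v, (M ∩ cutset src tgt {v}).card = 1) ∧ ∀ e ∈ M, 0 < x e :=
  let ⟨_, hH⟩ := SimpleGraph.tutte.2 (hx.not_isTutteViolator hr)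
  exists_matching_of_supportGraph hH

/-- Subtract from a fractional matching the largest possible multiple of a perfect matching. -/
lemma IsFracMatching.exists_sub {src tgt : E → V} {r : ℝ} {x : E → ℝ} {M : Finset E}
    (hx : IsFracMatching src tgt r x) (hM : ∀ v, (M ∩ cutset src tgt {v}).card = 1)
    (hpos : ∀ e ∈ M, 0 < x e) (hne : M.Nonempty)
    (hslack : ∀ S : Finset V, Odd S.card → 1 < (M ∩ cutset src tgt S).card →
      r < ∑ e ∈ cutset src tgt S, x e) :
    ∃ ε, 0 < ε ∧ ε ≤ r ∧
      IsFracMatching src tgt (r - ε) (fun e => x e - if e ∈ M then ε else 0) ∧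
      ((∃ e ∈ M, x e = ε) ∨ ∃ S : Finset V, Odd S.card ∧ 1 < (M ∩ cutset src tgt S).card ∧
        ∑ e ∈ cutset src tgt S, (x e - if e ∈ M then ε else 0) = r - ε) := by
  have hsum : ∀ (ε : ℝ) (S : Finset V), ∑ e ∈ cutset src tgt S, (x e - if e ∈ M then ε else 0) =
      ∑ e ∈ cutset src tgt S, x e - (M ∩ cutset src tgt S).card * ε := by
    intro ε S
    rw [Finset.sum_sub_distrib, ← Finset.sum_filter, Finset.filter_mem_eq_inter, inter_comm]
    simp
  set 𝒮 : Finset (Finset V) :=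
    univ.filter fun S => Odd S.card ∧ 1 < (M ∩ cutset src tgt S).card with h𝒮
  set q : Finset V → ℝ := fun S =>
    (∑ e ∈ cutset src tgt S, x e - r) / ((M ∩ cutset src tgt S).card - 1) with hq
  have hden : ∀ S ∈ 𝒮, (0 : ℝ) < (M ∩ cutset src tgt S).card - 1 := by
    intro S hS
    rw [sub_pos]
    exact_mod_cast (mem_filter.1 hS).2.2
  set B : Finset ℝ := M.image x ∪ 𝒮.image q with hB
  have hBne : B.Nonempty := (hne.image x).mono subset_union_left
  have hmem := B.min'_mem hBne
  have hmin : ∀ b ∈ B, B.min' hBne ≤ b := fun b hb => B.min'_le b hb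
  set ε := B.min' hBne with hε
  have hxε : ∀ e ∈ M, ε ≤ x e := fun e he =>
    hmin _ (mem_union_left _ (mem_image_of_mem x he))
  have hqε : ∀ S ∈ 𝒮, ε ≤ q S := fun S hS => hmin _ (mem_union_right _ (mem_image_of_mem q hS))
  refine ⟨ε, ?_, ?_, ⟨fun e => ?_, fun e he => ?_, fun v => ?_, fun S hS => ?_⟩, ?_⟩
  · rcases mem_union.1 hmem with h | h
    · obtain ⟨e, he, h⟩ := mem_image.1 h
      exact h ▸ hpos e he
    · obtain ⟨S, hS, h⟩ := mem_image.1 h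
      rw [← h]
      have hS' := (mem_filter.1 hS).2
      exact div_pos (sub_pos.2 (hslack S hS'.1 hS'.2)) (hden S hS)
  · obtain ⟨e, he⟩ := hne
    refine (hxε e he).trans ?_
    rw [← hx.deg (src e)]
    refine Finset.single_le_sum (f := x) (fun f _ => hx.nonneg f) ?_
    have : tgt e ≠ src e := fun h => (hpos e he).ne' (hx.loop e h.symm)
    simpa [mem_cutset] using this
  · by_cases h : e ∈ M
    · simpa [h] using hxε e h
    · simpa [h] using hx.nonneg e
  · have : e ∉ M := fun h => (hpos e h).ne' (hx.loop e he)
    simp [this, hx.loop e he]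
  · rw [hsum, hM, hx.deg]
    simp
  · rw [hsum]
    have hk : Odd (M ∩ cutset src tgt S).card :=
      odd_card_inter_cutset (fun v => by simp [hM v]) hS
    rcases (Nat.one_le_iff_ne_zero.2 hk.pos.ne').eq_or_lt with h | h
    · rw [← h]
      have := hx.odd S hS
      push_cast
      linarith
    · have hS𝒮 : S ∈ 𝒮 := mem_filter.2 ⟨mem_univ _, hS, h⟩
      have := (le_div_iff₀ (hden S hS𝒮)).1 (hqε S hS𝒮)
      linarith
  · rcases mem_union.1 hmem with h | h
    · obtain ⟨e, he, h⟩ := mem_image.1 h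
      exact Or.inl ⟨e, he, h⟩
    · obtain ⟨S, hS, h⟩ := mem_image.1 h
      refine Or.inr ⟨S, (mem_filter.1 hS).2.1, (mem_filter.1 hS).2.2, ?_⟩
      rw [hsum]
      have := (div_eq_iff (hden S hS).ne').1 h
      linarith

lemma matchingBound_of_contractions
    (ih : ∀ S : Finset V, S.card + 1 < Fintype.card V → MatchingBound (Option S) E) :
    MatchingBound V E := by
  intro src tgt r x w hr hx
  have htight : ∀ r x, 0 < r → IsFracMatching src tgt r x → ∀ S : Finset V, Odd S.card →
      S.card ≠ 1 → Sᶜ.card ≠ 1 → ∑ e ∈ cutset src tgt S, x e = r →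
      ∃ M : Finset E, (∀ v, (M ∩ cutset src tgt {v}).card = 1) ∧ (∀ e ∈ M, 0 < x e) ∧
        r * ∑ e ∈ M, w e ≤ ∑ e, w e * x e := by
    intro r x hr hx S hS hS1 hSc1 hSr
    have hcard := S.card_add_card_compl
    have hSc : Odd Sᶜ.card := by
      have := hx.even_card hr
      grind
    exact exists_matching_of_tight_cut hr hx hS hSc hSr (ih S (by grind)) (ih Sᶜ (by grind)) w
  induction hn : (univ.filter fun e => 0 < x e).card using Nat.strong_induction_on
    generalizing r x with | _ n ihn
  by_cases hex : ∃ S : Finset V, Odd S.card ∧ S.card ≠ 1 ∧ Sᶜ.card ≠ 1 ∧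
      ∑ e ∈ cutset src tgt S, x e = r
  · obtain ⟨S, hS, hS1, hSc1, hSr⟩ := hex
    exact htight r x hr hx S hS hS1 hSc1 hSr
  obtain ⟨M, hM, hMpos⟩ := hx.exists_matching hr
  have hbig : ∀ S : Finset V, 1 < (M ∩ cutset src tgt S).card → S.card ≠ 1 ∧ Sᶜ.card ≠ 1 := by
    refine fun S hS => ⟨fun h => ?_, fun h => ?_⟩
    · obtain ⟨v, rfl⟩ := Finset.card_eq_one.1 h
      exact hS.ne' (hM v)
    · obtain ⟨v, hv⟩ := Finset.card_eq_one.1 h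
      rw [← cutset_compl, hv] at hS
      exact hS.ne' (hM v)
  rcases M.eq_empty_or_nonempty with rfl | hMne
  · have : IsEmpty E := ⟨fun e => by simpa using hM (src e)⟩
    exact ⟨∅, hM, hMpos, by simp⟩
  obtain ⟨ε, hε, hεr, hy, hcases⟩ := hx.exists_sub hM hMpos hMne fun S hS hk =>
    (hx.odd S hS).lt_of_ne fun h => hex ⟨S, hS, (hbig S hk).1, (hbig S hk).2, h.symm⟩
  set y : E → ℝ := fun e => x e - if e ∈ M then ε else 0 with hydef
  have hyx : ∀ e, 0 < y e → 0 < x e := by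
    intro e he
    refine he.trans_le (sub_le_self _ ?_)
    split_ifs
    exacts [hε.le, le_rfl]
  have hwy : ∑ e, w e * y e = ∑ e, w e * x e - ε * ∑ e ∈ M, w e := by
    simp only [hydef, mul_sub, Finset.sum_sub_distrib, mul_ite, mul_zero]
    rw [← Finset.sum_filter, Finset.filter_mem_eq_inter, univ_inter, Finset.mul_sum]
    simp only [mul_comm]
  rcases hεr.eq_or_lt with heq | hlt
  · have hy0 : ∀ e, y e = 0 := by
      intro e
      by_cases hl : src e = tgt e
      · exact hy.loop e hl
      · have hs := hy.deg (src e)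
        rw [heq, sub_self, Finset.sum_eq_zero_iff_of_nonneg fun f _ => hy.nonneg f] at hs
        exact hs e (by simp [mem_cutset, eq_comm, hl])
    refine ⟨M, hM, hMpos, ?_⟩
    simp only [hy0, mul_zero, Finset.sum_const_zero] at hwy
    rw [← heq]
    linarith
  · obtain ⟨N, hN, hNpos, hNw⟩ : ∃ N : Finset E, (∀ v, (N ∩ cutset src tgt {v}).card = 1) ∧
        (∀ e ∈ N, 0 < y e) ∧ (r - ε) * ∑ e ∈ N, w e ≤ ∑ e, w e * y e := by
      rcases hcases with ⟨e, he, hxe⟩ | ⟨S, hS, hk, hSr⟩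
      · refine ihn _ ?_ (r - ε) y (sub_pos.2 hlt) hy rfl
        rw [← hn]
        refine Finset.card_lt_card (Finset.ssubset_iff_of_subset ?_ |>.2 ⟨e, ?_, ?_⟩)
        · exact fun f hf => mem_filter.2 ⟨mem_univ _, hyx f (mem_filter.1 hf).2⟩
        · simp [hMpos e he]
        · simp [hydef, he, hxe]
      · exact htight _ y (sub_pos.2 hlt) hy S hS (hbig S hk).1 (hbig S hk).2 hSr
    rw [hwy] at hNw
    rcases le_total (∑ e ∈ M, w e) (∑ e ∈ N, w e) with hle | hle
    · refine ⟨M, hM, hMpos, ?_⟩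
      nlinarith
    · refine ⟨N, hN, fun e he => hyx e (hNpos e he), ?_⟩
      nlinarith

/-- Edmonds' perfect matching polytope theorem, in terms of minimum weight matchings. -/
theorem matchingBound (V E : Type) [Fintype V] [Fintype E] [DecidableEq V] [DecidableEq E] :
    MatchingBound V E := by
  induction hn : Fintype.card V using Nat.strong_induction_on generalizing V with | _ n ih
  exact matchingBound_of_contractions fun S hS =>
    ih (Fintype.card (Option S)) (by simpa [← hn] using hS) (Option S) rfl

end FractionalMatching

section Cubic

variable {V E : Type} [Fintype E] [DecidableEq V] {src tgt : E → V}

lemma odd_card_cutset_of_cubic (hcubic : ∀ v : V, degr src tgt univ v = 3) {S : Finset V}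
    (hS : Odd S.card) : Odd (cutset src tgt S).card := by
  classical
  have key : ∀ v, ((univ ∩ cutset src tgt {v}).card : ZMod 2) = (degr src tgt univ v : ZMod 2) := by
    intro v
    simp only [degr, Finset.card_filter, univ_inter, cutset]
    push_cast
    rw [← Finset.sum_add_distrib]
    refine Finset.sum_congr rfl fun e _ => ?_
    by_cases h1 : src e = v <;> by_cases h2 : tgt e = v <;> simp [h1, h2]
    decide
  rw [← univ_inter (cutset src tgt S)]
  refine odd_card_inter_cutset (fun v => ?_) hS
  rw [← ZMod.natCast_eq_one_iff_odd, key, hcubic]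
  decide

lemma card_filter_add_of_no_loops [DecidableEq E] (hloop : ∀ e, src e ≠ tgt e)
    (M : Finset E) (v : V) :
    (M.filter fun e => src e = v).card + (M.filter fun e => tgt e = v).card =
      (M ∩ cutset src tgt {v}).card := by
  rw [← Finset.card_union_of_disjoint]
  · congr 1
    ext e
    have := hloop e
    simp only [mem_union, mem_filter, mem_inter, mem_cutset, mem_singleton]
    grind
  · refine Finset.disjoint_left.2 fun e h1 h2 => hloop e ?_
    rw [(mem_filter.1 h1).2, (mem_filter.1 h2).2]

variable [Fintype V]

lemma three_le_card_cutset (hcubic : ∀ v : V, degr src tgt univ v = 3)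
    (h2ec : EdgeConnected src tgt 2) {S : Finset V} (hS : Odd S.card) :
    3 ≤ (cutset src tgt S).card := by
  have hodd := odd_card_cutset_of_cubic hcubic hS
  have hne : S ≠ univ := by
    rintro rfl
    simp [cutset] at hodd
  have := h2ec S (Finset.card_pos.1 hS.pos) hne
  grind

lemma src_ne_tgt_of_cubic (hcubic : ∀ v : V, degr src tgt univ v = 3)
    (h2ec : EdgeConnected src tgt 2) (e : E) : src e ≠ tgt e := by
  classical
  intro he
  have h3 := three_le_card_cutset hcubic h2ec (S := {src e}) (by simp)
  have hdeg := hcubic (src e)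
  have hlt : (cutset src tgt {src e}).card < degr src tgt univ (src e) := by
    rw [degr, ← Finset.card_union_add_card_inter]
    have h1 : (cutset src tgt {src e}).card ≤ ((univ.filter fun f => src f = src e) ∪
        (univ.filter fun f => tgt f = src e)).card := by
      refine Finset.card_le_card fun f hf => ?_
      simp only [mem_cutset, mem_singleton] at hf
      simp only [mem_union, mem_filter, mem_univ, true_and]
      tauto
    have h2 : 0 < ((univ.filter fun f => src f = src e) ∩
        (univ.filter fun f => tgt f = src e)).card :=
      Finset.card_pos.2 ⟨e, by simp [he]⟩
    omega
  omega

lemma card_cutset_singleton_of_cubic (hcubic : ∀ v : V, degr src tgt univ v = 3)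
    (h2ec : EdgeConnected src tgt 2) (v : V) : (cutset src tgt {v}).card = 3 := by
  classical
  rw [← hcubic v, degr, card_filter_add_of_no_loops (src_ne_tgt_of_cubic hcubic h2ec), univ_inter]

/-- In a bridgeless cubic graph, some perfect matching of at most a third of the total weight
meets every odd cut of size three exactly once. -/
lemma exists_matching_third [DecidableEq E] (hcubic : ∀ v : V, degr src tgt univ v = 3)
    (h2ec : EdgeConnected src tgt 2) {w : E → ℝ} (hw : ∀ e, 0 ≤ w e) :
    ∃ M : Finset E, (∀ v, (M ∩ cutset src tgt {v}).card = 1) ∧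
      (∀ S : Finset V, Odd S.card → (cutset src tgt S).card = 3 →
        (M ∩ cutset src tgt S).card = 1) ∧
      3 * ∑ e ∈ M, w e ≤ ∑ e, w e := by
  have hloop := src_ne_tgt_of_cubic hcubic h2ec
  have hx : IsFracMatching src tgt 3 (fun _ => 1) := by
    refine ⟨fun _ => zero_le_one, fun e he => (hloop e he).elim, fun v => ?_, fun S hS => ?_⟩
    · simp [card_cutset_singleton_of_cubic hcubic h2ec]
    · simpa using three_le_card_cutset hcubic h2ec hS
  set W := ∑ e, w e with hW
  have hW0 : 0 ≤ W := Finset.sum_nonneg fun e _ => hw e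
  set 𝒮 : Finset (Finset V) :=
    univ.filter fun S => Odd S.card ∧ (cutset src tgt S).card = 3 with h𝒮
  obtain ⟨M, hM, -, hle⟩ := matchingBound V E src tgt 3 _
    (fun e => w e + (W + 1) * ∑ S ∈ 𝒮, if e ∈ cutset src tgt S then 1 else 0)
    (by norm_num) hx
  have hcount : ∀ N : Finset E, ∑ e ∈ N, ∑ S ∈ 𝒮, (if e ∈ cutset src tgt S then (1 : ℝ) else 0) =
      ∑ S ∈ 𝒮, ((N ∩ cutset src tgt S).card : ℝ) := by
    intro N
    rw [Finset.sum_comm]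
    refine Finset.sum_congr rfl fun S _ => ?_
    rw [← Finset.sum_filter, Finset.filter_mem_eq_inter]
    simp
  simp only [mul_one, Finset.sum_add_distrib, ← Finset.mul_sum, hcount, univ_inter] at hle
  have h3 : ∑ S ∈ 𝒮, ((cutset src tgt S).card : ℝ) = ∑ S ∈ 𝒮, 3 :=
    Finset.sum_congr rfl fun S hS => by simp [(mem_filter.1 hS).2.2]
  have hone : ∀ S ∈ 𝒮, (1 : ℝ) ≤ (M ∩ cutset src tgt S).card := by
    intro S hS
    exact_mod_cast (odd_card_inter_cutset (fun v => by simp [hM v]) (mem_filter.1 hS).2.1).pos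
  have hexcess : ∑ S ∈ 𝒮, (((M ∩ cutset src tgt S).card : ℝ) - 1) =
      ∑ S ∈ 𝒮, ((M ∩ cutset src tgt S).card : ℝ) - 𝒮.card := by
    simp
  rw [h3, Finset.sum_const, nsmul_eq_mul] at hle
  have hM0 : 0 ≤ ∑ e ∈ M, w e := Finset.sum_nonneg fun e _ => hw e
  have hbound : 3 * ∑ e ∈ M, w e +
      3 * (W + 1) * ∑ S ∈ 𝒮, (((M ∩ cutset src tgt S).card : ℝ) - 1) ≤ W := by
    rw [hexcess]
    linarith
  have hnn : ∀ S ∈ 𝒮, (0 : ℝ) ≤ (M ∩ cutset src tgt S).card - 1 :=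
    fun S hS => sub_nonneg.2 (hone S hS)
  refine ⟨M, hM, fun S hS hS3 => ?_, ?_⟩
  · by_contra hne
    have hS𝒮 : S ∈ 𝒮 := mem_filter.2 ⟨mem_univ _, hS, hS3⟩
    have h1 := Finset.single_le_sum (f := fun S => ((M ∩ cutset src tgt S).card : ℝ) - 1) hnn hS𝒮
    have h2 : (2 : ℝ) ≤ (M ∩ cutset src tgt S).card := by
      have : 1 ≤ (M ∩ cutset src tgt S).card := by exact_mod_cast hone S hS𝒮
      exact_mod_cast (show 2 ≤ (M ∩ cutset src tgt S).card by omega)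
    nlinarith
  · have := mul_nonneg (by linarith : (0 : ℝ) ≤ 3 * (W + 1)) (Finset.sum_nonneg hnn)
    linarith

end Cubic

/-- (Kaiser–Kráľ–Norine.)  Let `G` be a 2-edge-connected cubic finite graph and
`w : E(G) → [0,∞)` a weighting of the edges.  Then `G` contains two perfect matchings
`M₁`, `M₂` such that `w(M₁ ∩ M₂) ≤ w(E(G))/15`. -/
theorem two_matchings_small_intersection
    (V E : Type) [Fintype V] [Fintype E] [DecidableEq V] [DecidableEq E]
    (src tgt : E → V)
    (hcubic : ∀ v : V, degr src tgt Finset.univ v = 3)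
    (h2ec : EdgeConnected src tgt 2)
    (w : E → ℝ) (hw : ∀ e : E, 0 ≤ w e) :
    ∃ M₁ M₂ : Finset E,
      IsPerfectMatching src tgt M₁ ∧ IsPerfectMatching src tgt M₂ ∧
      15 * ∑ e ∈ M₁ ∩ M₂, w e ≤ ∑ e : E, w e := by
  have hloop := src_ne_tgt_of_cubic hcubic h2ec
  obtain ⟨M₁, hM₁, hcut, hw₁⟩ := exists_matching_third hcubic h2ec hw
  have hsum : ∀ S : Finset V, ∑ e ∈ cutset src tgt S, (if e ∈ M₁ then (1 : ℝ) else 2) =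
      2 * (cutset src tgt S).card - (M₁ ∩ cutset src tgt S).card := by
    intro S
    have : ∀ e, (if e ∈ M₁ then (1 : ℝ) else 2) = 2 - if e ∈ M₁ then 1 else 0 := by
      intro e
      split_ifs <;> norm_num
    simp only [this]
    rw [Finset.sum_sub_distrib, ← Finset.sum_filter, Finset.filter_mem_eq_inter, inter_comm]
    simp [mul_comm]
  have hx : IsFracMatching src tgt 5 (fun e => if e ∈ M₁ then 1 else 2) := by
    refine ⟨fun e => ?_, fun e he => (hloop e he).elim, fun v => ?_, fun S hS => ?_⟩
    · split_ifs <;> norm_num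
    · rw [hsum, hM₁, card_cutset_singleton_of_cubic hcubic h2ec]
      norm_num
    · rw [hsum]
      by_cases h3 : (cutset src tgt S).card = 3
      · rw [hcut S hS h3, h3]
        norm_num
      · have hge := three_le_card_cutset hcubic h2ec hS
        have hodd := odd_card_cutset_of_cubic hcubic hS
        have h5 : (5 : ℝ) ≤ (cutset src tgt S).card := by
          exact_mod_cast (show 5 ≤ (cutset src tgt S).card by grind)
        have hle : ((M₁ ∩ cutset src tgt S).card : ℝ) ≤ (cutset src tgt S).card := by
          exact_mod_cast Finset.card_le_card inter_subset_right
        linarith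
  obtain ⟨M₂, hM₂, -, hw₂⟩ := matchingBound V E src tgt 5 _
    (fun e => if e ∈ M₁ then w e else 0) (by norm_num) hx
  have h1 : ∑ e ∈ M₂, (if e ∈ M₁ then w e else 0) = ∑ e ∈ M₁ ∩ M₂, w e := by
    rw [← Finset.sum_filter, Finset.filter_mem_eq_inter, inter_comm]
  have h2 : ∑ e, (if e ∈ M₁ then w e else 0) * (if e ∈ M₁ then (1 : ℝ) else 2) =
      ∑ e ∈ M₁, w e := by
    rw [← univ_inter M₁, ← Finset.sum_ite_mem]
    refine Finset.sum_congr rfl fun e _ => ?_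
    by_cases he : e ∈ M₁ <;> simp [he]
  rw [h1, h2] at hw₂
  refine ⟨M₁, M₂, fun v => ?_, fun v => ?_, by linarith⟩
  · rw [card_filter_add_of_no_loops hloop, hM₁]
  · rw [card_filter_add_of_no_loops hloop, hM₂]
end

section
/- For every integer j ≥ 1, every 2j-edge-connected finite graph G (loops and multiple edges allowed) has an integer 2-flow φ with |supp(φ)| ≥ (2j/(2j+1))|E(G)|. -/
open Finset

section Joins

theorem two_eq_zero_parity {V : Type} : (2 : V → ZMod 2) = 0 := by
  funext v
  exact (by decide : (2 : ZMod 2) = 0)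

variable {V E : Type} [DecidableEq V] (src tgt : E → V)

/-- The indicator function of a vertex, with values in `ℤ/2`. -/
def pointMass (v : V) : V → ZMod 2 := Pi.single v 1

/-- The boundary modulo 2 of an edge set: the indicator of its vertices of odd degree. -/
def parity (F : Finset E) : V → ZMod 2 :=
  ∑ e ∈ F, (pointMass (src e) + pointMass (tgt e))

/-- The edge `e` joins `x` and `y`. -/
def Joins (e : E) (x y : V) : Prop :=
  (src e = x ∧ tgt e = y) ∨ (src e = y ∧ tgt e = x)

variable {src tgt}

theorem pointMass_ne {x y : V} (h : x ≠ y) : pointMass x y = 0 := by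
  simp [pointMass, h.symm]

theorem pointMass_self (x : V) : pointMass x x = 1 := by
  simp [pointMass]

theorem Joins.pointMass_add {e : E} {x y : V} (h : Joins src tgt e x y) :
    pointMass (src e) + pointMass (tgt e) = pointMass x + pointMass y := by
  rcases h with ⟨rfl, rfl⟩ | ⟨rfl, rfl⟩
  · rfl
  · exact add_comm _ _

theorem parity_empty : parity src tgt (∅ : Finset E) = 0 := by
  simp [parity]

theorem eq_of_pointMass_add_eq_zero {x y : V} (h : pointMass x + pointMass y = 0) : x = y := by
  by_contra hxy
  have := congrFun h x
  simp [pointMass_self, pointMass_ne (Ne.symm hxy)] at this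

theorem exists_joins_of_parity_ne_zero {F : Finset E} {x : V} (h : parity src tgt F x ≠ 0) :
    ∃ e ∈ F, ∃ y, y ≠ x ∧ Joins src tgt e x y := by
  by_contra! hcon
  apply h
  rw [parity, Finset.sum_apply]
  refine Finset.sum_eq_zero fun e he => ?_
  by_cases h1 : src e = x
  · by_cases h2 : tgt e = x
    · simp only [Pi.add_apply, h1, h2]
      exact CharTwo.add_self_eq_zero _
    · exact absurd (Or.inl ⟨h1, rfl⟩) (hcon e he _ h2)
  · by_cases h2 : tgt e = x
    · exact absurd (Or.inr ⟨rfl, h2⟩) (hcon e he _ h1)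
    · simp [pointMass_ne h1, pointMass_ne h2]

theorem exists_joins_of_parity_eq {F : Finset E} {x y : V}
    (h : parity src tgt F = pointMass x + pointMass y) (hxy : x ≠ y) :
    ∃ e ∈ F, ∃ z, z ≠ x ∧ Joins src tgt e x z := by
  apply exists_joins_of_parity_ne_zero
  rw [h]
  simp [pointMass_self, pointMass_ne hxy.symm]

theorem mem_cutset_singleton [Fintype E] {e : E} {b : V} :
    e ∈ cutset src tgt {b} ↔ ∃ y, y ≠ b ∧ Joins src tgt e b y := by
  simp only [cutset, Finset.mem_filter, Finset.mem_univ, true_and, Finset.mem_singleton, Joins]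
  constructor
  · rintro (⟨h1, h2⟩ | ⟨h1, h2⟩)
    · exact ⟨_, h2, Or.inl ⟨h1, rfl⟩⟩
    · exact ⟨_, h2, Or.inr ⟨rfl, h1⟩⟩
  · rintro ⟨y, hy, ⟨h1, rfl⟩ | ⟨rfl, h1⟩⟩
    · exact Or.inl ⟨h1, hy⟩
    · exact Or.inr ⟨h1, hy⟩

theorem Joins.mem_cutset_singleton [Fintype E] {e : E} {x y b : V} (h : Joins src tgt e x y) :
    e ∈ cutset src tgt {b} ↔ (x = b ∧ y ≠ b) ∨ (y = b ∧ x ≠ b) := by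
  simp only [cutset, Finset.mem_filter, Finset.mem_univ, true_and, Finset.mem_singleton]
  rcases h with ⟨rfl, rfl⟩ | ⟨rfl, rfl⟩ <;> tauto

/-- `F` is a join of negative weight between `a` and `b`, of least weight among all joins between
two vertices, and of least cardinality among those of least weight. -/
structure IsLeastJoin (src tgt : E → V) (w : E → ℤ) (a b : V) (F : Finset E) : Prop where
  parity_eq : parity src tgt F = pointMass a + pointMass b
  neg : ∑ e ∈ F, w e < 0
  weight_le : ∀ a' b' F', parity src tgt F' = pointMass a' + pointMass b' →
    ∑ e ∈ F, w e ≤ ∑ e ∈ F', w e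
  card_le : ∀ a' b' F', parity src tgt F' = pointMass a' + pointMass b' →
    ∑ e ∈ F', w e ≤ ∑ e ∈ F, w e → F.card ≤ F'.card

theorem exists_isLeastJoin [Fintype V] [Fintype E] {w : E → ℤ} {e : E} (he : w e < 0) :
    ∃ a b F, IsLeastJoin src tgt w a b F := by
  classical
  let S : Finset (V × V × Finset E) := Finset.univ.filter fun p =>
    parity src tgt p.2.2 = pointMass p.1 + pointMass p.2.1
  have he' : (src e, tgt e, ({e} : Finset E)) ∈ S := by
    refine Finset.mem_filter.2 ⟨Finset.mem_univ _, ?_⟩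
    simp [parity]
  obtain ⟨⟨a, b, F⟩, hF, hmin⟩ := Finset.exists_min_image S
    (fun p => toLex (∑ e ∈ p.2.2, w e, p.2.2.card)) ⟨_, he'⟩
  have hle : ∀ a' b' F', parity src tgt F' = pointMass a' + pointMass b' →
      ∑ e ∈ F, w e < ∑ e ∈ F', w e ∨ ∑ e ∈ F, w e = ∑ e ∈ F', w e ∧ F.card ≤ F'.card := by
    intro a' b' F' h
    have := hmin (a', b', F') (by simpa [S] using h)
    simpa [Prod.Lex.toLex_le_toLex] using this
  refine ⟨a, b, F, by simpa [S] using hF, ?_, fun a' b' F' h => ?_, fun a' b' F' h h' => ?_⟩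
  · have := hle (src e) (tgt e) {e} (by simpa [S] using he')
    simp only [Finset.sum_singleton] at this
    omega
  · have := hle a' b' F' h
    omega
  · have := hle a' b' F' h
    omega

theorem IsLeastJoin.ne {w : E → ℤ} {a b : V} {F : Finset E}
    (h : IsLeastJoin src tgt w a b F)
    (hw : ∀ C, parity src tgt C = 0 → 0 ≤ ∑ e ∈ C, w e) : a ≠ b := by
  rintro rfl
  have two := two_eq_zero_parity (V := V)
  have := hw F (h.parity_eq.trans (by grind))
  have := h.neg
  omega

/-- Identify the end `tgt e` of the edge `e` with its other end `src e`. -/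
def contractMap (src tgt : E → V) (e : E) (v : V) : V :=
  if v = tgt e then src e else v

theorem cutset_contract [Fintype V] [Fintype E] (e : E) (U : Finset V) :
    cutset (contractMap src tgt e ∘ src) (contractMap src tgt e ∘ tgt) U =
      cutset src tgt (Finset.univ.filter fun v => contractMap src tgt e v ∈ U) := by
  ext f
  simp [cutset]

variable [DecidableEq E]

theorem parity_insert {F : Finset E} {e : E} {x y : V} (he : e ∉ F)
    (h : Joins src tgt e x y) :
    parity src tgt (insert e F) = pointMass x + pointMass y + parity src tgt F := by
  rw [parity, Finset.sum_insert he, h.pointMass_add, parity]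

theorem parity_sdiff {F D : Finset E} (h : D ⊆ F) :
    parity src tgt (F \ D) = parity src tgt F + parity src tgt D := by
  have h1 : parity src tgt (F \ D) + parity src tgt D = parity src tgt F :=
    Finset.sum_sdiff h
  have := two_eq_zero_parity (V := V)
  grind

theorem parity_union {F D : Finset E} (h : Disjoint F D) :
    parity src tgt (F ∪ D) = parity src tgt F + parity src tgt D :=
  Finset.sum_union h

theorem parity_erase {F : Finset E} {e : E} {x y : V} (he : e ∈ F)
    (h : Joins src tgt e x y) :
    parity src tgt (F.erase e) = pointMass x + pointMass y + parity src tgt F := by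
  have h1 := parity_insert (Finset.notMem_erase e F) h
  rw [Finset.insert_erase he] at h1
  have := two_eq_zero_parity (V := V)
  grind

theorem parity_symmDiff (F D : Finset E) :
    parity src tgt (symmDiff F D) = parity src tgt F + parity src tgt D := by
  have h1 : parity src tgt (F \ D) = parity src tgt F + parity src tgt (F ∩ D) := by
    rw [← parity_sdiff Finset.inter_subset_left, Finset.sdiff_inter_self_left]
  have h2 : parity src tgt (D \ F) = parity src tgt D + parity src tgt (F ∩ D) := by
    rw [← parity_sdiff Finset.inter_subset_right, Finset.inter_comm,
      Finset.sdiff_inter_self_left]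
  rw [symmDiff, Finset.sup_eq_union, parity_union disjoint_sdiff_sdiff, h1, h2]
  have := two_eq_zero_parity (V := V)
  grind

/-- The parity of the intersection with a cut is read off from the boundary modulo 2. -/
theorem card_inter_cutset_eq_sum_parity [Fintype E] (F : Finset E) (U : Finset V) :
    ((F ∩ cutset src tgt U).card : ZMod 2) = ∑ v ∈ U, parity src tgt F v := by
  simp only [parity, Finset.sum_apply]
  rw [Finset.sum_comm, Finset.card_eq_sum_ones, ← Finset.filter_mem_eq_inter,
    Finset.sum_filter, Nat.cast_sum]
  refine Finset.sum_congr rfl fun e _ => ?_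
  simp only [Pi.add_apply, Finset.sum_add_distrib, pointMass, Pi.single_apply, cutset,
    Finset.mem_filter, Finset.mem_univ, true_and, Finset.sum_ite_eq']
  by_cases h1 : src e ∈ U <;> by_cases h2 : tgt e ∈ U <;> simp [h1, h2]
  all_goals decide

theorem even_card_inter_cutset [Fintype E] {F : Finset E} (h : parity src tgt F = 0)
    (U : Finset V) : Even (F ∩ cutset src tgt U).card := by
  rw [← ZMod.natCast_eq_zero_iff_even, card_inter_cutset_eq_sum_parity, h]
  simp

/-- An edge set all of whose odd vertices are `b` and `x` carries a unit flow from `b` to `x`. -/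
theorem exists_unit_flow [Fintype E] (F : Finset E) :
    ∀ b x : V, parity src tgt F = pointMass b + pointMass x →
      ∃ φ : E → ℤ, (∀ v, bdry src tgt φ v = Pi.single (M := fun _ => ℤ) b 1 v -
        Pi.single (M := fun _ => ℤ) x 1 v) ∧ (∀ e, |φ e| ≤ 1) ∧ ∀ e, φ e ≠ 0 ↔ e ∈ F := by
  induction F using Finset.strongInduction with
  | H F ih =>
    have step : ∀ e ∈ F, ∀ u v x : V, Joins src tgt e u v →
        parity src tgt F = pointMass u + pointMass x →
        ∃ φ : E → ℤ, (∀ w, bdry src tgt φ w = Pi.single (M := fun _ => ℤ) u 1 w -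
          Pi.single (M := fun _ => ℤ) x 1 w) ∧ (∀ e, |φ e| ≤ 1) ∧ ∀ e, φ e ≠ 0 ↔ e ∈ F := by
      intro e he u v x hj hp
      have hp' : parity src tgt (F.erase e) = pointMass v + pointMass x := by
        rw [parity_erase he hj, hp]
        have := two_eq_zero_parity (V := V)
        grind
      obtain ⟨φ, h1, h2, h3⟩ := ih _ (Finset.erase_ssubset he) v x hp'
      have h0 : φ e = 0 := by
        by_contra h
        exact Finset.notMem_erase e F ((h3 e).1 h)
      have key : ∀ a : ℤ, ∀ w, bdry src tgt (fun f => φ f + if f = e then a else 0) w =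
          bdry src tgt φ w + ((if src e = w then a else 0) - if tgt e = w then a else 0) := by
        intro a w
        have : ∀ g : E → V, (∑ f : E, if g f = w then φ f + (if f = e then a else 0) else 0) =
            (∑ f : E, if g f = w then φ f else 0) + if g e = w then a else 0 := by
          intro g
          have h4 : ∀ f, (if g f = w then φ f + (if f = e then a else 0) else 0) =
              (if g f = w then φ f else 0) + if f = e then (if g e = w then a else 0) else 0 := by
            intro f
            by_cases hf : f = e
            · subst hf
              by_cases hw : g f = w <;> simp [hw]
            · simp [hf]
          simp only [h4, Finset.sum_add_distrib, Finset.sum_ite_eq', Finset.mem_univ, if_true]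
        simp only [bdry, this]
        ring
      have fin : ∀ a : ℤ, |a| = 1 →
          (∀ f, |φ f + if f = e then a else 0| ≤ 1) ∧
          ∀ f, (φ f + if f = e then a else 0) ≠ 0 ↔ f ∈ F := by
        intro a ha
        have ha0 : a ≠ 0 := by
          rintro rfl
          simp at ha
        constructor
        · intro f
          by_cases hf : f = e
          · simp [hf, h0, ha]
          · simpa [hf] using h2 f
        · intro f
          by_cases hf : f = e
          · simp [hf, h0, ha0, he]
          · simpa [hf] using h3 f
      rcases hj with ⟨hu, hv⟩ | ⟨hv, hu⟩
      · refine ⟨_, fun w => ?_, fin 1 (by simp)⟩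
        rw [key, h1, hu, hv]
        simp only [Pi.single_apply, eq_comm (a := w)]
        ring
      · refine ⟨_, fun w => ?_, fin (-1) (by simp)⟩
        rw [key, h1, hu, hv]
        simp only [Pi.single_apply, eq_comm (a := w)]
        split_ifs <;> ring
    intro b x hp
    rcases F.eq_empty_or_nonempty with rfl | ⟨e, he⟩
    · rw [parity_empty] at hp
      obtain rfl := eq_of_pointMass_add_eq_zero hp.symm
      exact ⟨0, by simp [bdry], by simp, by simp⟩
    · by_cases hbx : b = x
      · subst hbx
        have two := two_eq_zero_parity (V := V)
        obtain ⟨φ, h1, h2⟩ := step e he (src e) (tgt e) (src e) (Or.inl ⟨rfl, rfl⟩)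
          (by rw [hp]; grind)
        exact ⟨φ, by simpa using h1, h2⟩
      · obtain ⟨f, hf, z, -, hj⟩ := exists_joins_of_parity_eq hp hbx
        exact step f hf b z x hj hp

/-- An inclusion-minimal join has at most one non-loop edge at its end, and an inclusion-minimal
cycle has at most two non-loop edges at each vertex. -/
theorem card_inter_cutset_le_of_minimal [Fintype E] {F : Finset E} {a b : V}
    (hF : parity src tgt F = pointMass a + pointMass b)
    (hmin : ∀ D ⊆ F, D.Nonempty → parity src tgt D = 0 → D = F) :
    (F ∩ cutset src tgt {b}).card ≤ if a = b then 2 else 1 := by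
  rcases (F ∩ cutset src tgt {b}).eq_empty_or_nonempty with h0 | ⟨f, hf⟩
  · simp [h0]
  obtain ⟨hfF, hfb⟩ := Finset.mem_inter.1 hf
  obtain ⟨y, hyb, hfy⟩ := mem_cutset_singleton.1 hfb
  have two := two_eq_zero_parity (V := V)
  classical
  let S : Finset (Finset E) := F.powerset.filter fun D =>
    (D ∩ cutset src tgt {b}).card = 1 ∧ ∃ x, parity src tgt D = pointMass b + pointMass x
  have hS : S.Nonempty := by
    refine ⟨{f}, ?_⟩
    simp only [S, Finset.mem_filter, Finset.mem_powerset, Finset.singleton_subset_iff]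
    refine ⟨hfF, ?_, y, ?_⟩
    · rw [Finset.singleton_inter_of_mem hfb, Finset.card_singleton]
    · rw [← insert_empty_eq, parity_insert (Finset.notMem_empty f) hfy, parity_empty, add_zero]
  obtain ⟨D, hDS, hDmax⟩ := Finset.exists_max_image S Finset.card hS
  simp only [S, Finset.mem_filter, Finset.mem_powerset] at hDS hDmax
  obtain ⟨hDF, hD1, x, hDx⟩ := hDS
  have hDne : D.Nonempty := by
    rw [Finset.nonempty_iff_ne_empty]
    rintro rfl
    simp at hD1
  have hxb : x ≠ b := by
    rintro rfl
    have := even_card_inter_cutset (hDx.trans (by grind)) {x}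
    rw [hD1] at this
    exact absurd this (by decide)
  have hrest : parity src tgt (F \ D) = pointMass x + pointMass a := by
    rw [parity_sdiff hDF, hF, hDx]
    grind
  by_cases hxa : x = a
  · subst hxa
    have : F \ D = ∅ := by
      by_contra hne
      have h1 := hmin (F \ D) Finset.sdiff_subset (Finset.nonempty_iff_ne_empty.2 hne)
        (by rw [hrest]; grind)
      obtain ⟨d, hd⟩ := hDne
      have := hDF hd
      rw [← h1] at this
      exact (Finset.mem_sdiff.1 this).2 hd
    have : F = D := (Finset.sdiff_eq_empty_iff_subset.1 this).antisymm hDF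
    rw [this, if_neg hxb, hD1]
  · obtain ⟨e, he, z, hzx, hez⟩ := exists_joins_of_parity_eq hrest hxa
    obtain ⟨heF, heD⟩ := Finset.mem_sdiff.1 he
    have hins : insert e D ⊆ F := Finset.insert_subset heF hDF
    have hpar : parity src tgt (insert e D) = pointMass b + pointMass z := by
      rw [parity_insert heD hez, hDx]
      grind
    by_cases hzb : z = b
    · subst hzb
      have h1 := hmin _ hins (Finset.insert_nonempty _ _) (by rw [hpar]; grind)
      have haz : a = z := by
        apply eq_of_pointMass_add_eq_zero
        rw [← hF, ← h1, hpar]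
        grind
      rw [if_pos haz, ← h1]
      have : insert e D ∩ cutset src tgt {z} ⊆ insert e (D ∩ cutset src tgt {z}) := by
        intro g
        simp only [Finset.mem_inter, Finset.mem_insert]
        tauto
      have h2 := (Finset.card_le_card this).trans (Finset.card_insert_le _ _)
      omega
    · have hcut : insert e D ∩ cutset src tgt {b} = D ∩ cutset src tgt {b} := by
        refine Finset.insert_inter_of_notMem ?_
        rw [hez.mem_cutset_singleton]
        tauto
      have := hDmax (insert e D) ⟨hins, by rw [hcut, hD1], z, hpar⟩
      rw [Finset.card_insert_of_notMem heD] at this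
      omega

/-- Any two vertices of an inclusion-minimal cycle are joined by a part of it. -/
theorem exists_subset_parity_of_minimal {C : Finset E} {b z : V}
    (hC : parity src tgt C = 0)
    (hmin : ∀ D ⊆ C, D.Nonempty → parity src tgt D = 0 → D = C)
    {f g : E} {y u : V} (hf : f ∈ C) (hfb : Joins src tgt f b y)
    (hg : g ∈ C) (hgz : Joins src tgt g z u) :
    ∃ D ⊆ C, parity src tgt D = pointMass b + pointMass z := by
  classical
  let R : V → Prop := fun x => ∃ D ⊆ C, parity src tgt D = pointMass b + pointMass x
  have two := two_eq_zero_parity (V := V)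
  have hstep : ∀ e ∈ C, ∀ x x', Joins src tgt e x x' → R x → R x' := by
    rintro e he x x' hj ⟨D, hDC, hD⟩
    by_cases heD : e ∈ D
    · refine ⟨D.erase e, (Finset.erase_subset _ _).trans hDC, ?_⟩
      rw [parity_erase heD hj, hD]
      grind
    · refine ⟨insert e D, Finset.insert_subset he hDC, ?_⟩
      rw [parity_insert heD hj, hD]
      grind
  have hRb : R b := ⟨∅, Finset.empty_subset _, by rw [parity_empty]; grind⟩
  have hends : ∀ e ∈ C, (R (src e) ↔ R (tgt e)) := fun e he =>
    ⟨hstep e he _ _ (Or.inl ⟨rfl, rfl⟩), hstep e he _ _ (Or.inr ⟨rfl, rfl⟩)⟩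
  have hjoin : ∀ e ∈ C, ∀ x x', Joins src tgt e x x' → (R (src e) ↔ R x) := by
    rintro e he x x' (⟨rfl, rfl⟩ | ⟨rfl, rfl⟩)
    · rfl
    · exact hends e he
  have hpar : parity src tgt (C.filter fun e => R (src e)) = 0 := by
    funext v
    by_cases hv : R v
    · have : parity src tgt (C.filter fun e => R (src e)) v = parity src tgt C v := by
        rw [parity, parity, Finset.sum_apply, Finset.sum_apply, Finset.sum_filter]
        refine Finset.sum_congr rfl fun e he => ?_
        split_ifs with h
        · rfl
        · have h1 : src e ≠ v := fun h1 => h (h1 ▸ hv)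
          have h2 : tgt e ≠ v := fun h2 => h ((hends e he).2 (h2 ▸ hv))
          simp [pointMass_ne h1, pointMass_ne h2]
      rw [this, hC]
    · rw [parity, Finset.sum_apply]
      refine Finset.sum_eq_zero fun e he => ?_
      obtain ⟨he, h⟩ := Finset.mem_filter.1 he
      have h1 : src e ≠ v := fun h1 => hv (h1 ▸ h)
      have h2 : tgt e ≠ v := fun h2 => hv (h2 ▸ (hends e he).1 h)
      simp [pointMass_ne h1, pointMass_ne h2]
  have heq := hmin _ (Finset.filter_subset _ _)
    ⟨f, Finset.mem_filter.2 ⟨hf, (hjoin f hf _ _ hfb).2 hRb⟩⟩ hpar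
  rw [← heq] at hg
  obtain ⟨hg, hRg⟩ := Finset.mem_filter.1 hg
  exact (hjoin g hg _ _ hgz).1 hRg

/-- The weight that counts edges of `J` negatively. -/
def signedWeight (J : Finset E) (c : E → ℤ) (e : E) : ℤ :=
  if e ∈ J then -c e else c e

theorem even_sum_signedWeight {J C : Finset E} {c : E → ℤ} (h : Even (∑ e ∈ C, c e)) :
    Even (∑ e ∈ C, signedWeight J c e) := by
  have : ∑ e ∈ C, signedWeight J c e = ∑ e ∈ C, c e - 2 * ∑ e ∈ C, if e ∈ J then c e else 0 := by
    rw [Finset.mul_sum, ← Finset.sum_sub_distrib]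
    refine Finset.sum_congr rfl fun e _ => ?_
    unfold signedWeight
    split_ifs <;> ring
  rw [this]
  exact h.sub (even_two_mul _)

theorem sum_signedWeight_sub (J C K : Finset E) (c : E → ℤ) :
    ∑ e ∈ C, signedWeight J (fun e => c e - if e ∈ K then 1 else 0) e =
      ∑ e ∈ C, signedWeight J c e - (C ∩ K).card + 2 * (C ∩ K ∩ J).card := by
  have h1 : ((C ∩ K).card : ℤ) = ∑ e ∈ C, if e ∈ K then 1 else 0 := by
    rw [← Finset.sum_filter, Finset.filter_mem_eq_inter]
    simp
  have h2 : ((C ∩ K ∩ J).card : ℤ) = ∑ e ∈ C, if e ∈ K ∧ e ∈ J then 1 else 0 := by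
    rw [← Finset.sum_filter, Finset.inter_assoc, ← Finset.filter_mem_eq_inter]
    simp
  rw [h1, h2, Finset.mul_sum, ← Finset.sum_sub_distrib, ← Finset.sum_add_distrib]
  refine Finset.sum_congr rfl fun e _ => ?_
  unfold signedWeight
  by_cases hK : e ∈ K <;> by_cases hJ : e ∈ J <;> simp [hK, hJ]
  all_goals ring

/-- It suffices to check nonnegativity of a weight on inclusion-minimal cycles. -/
theorem sum_nonneg_of_minimal {w : E → ℤ}
    (h : ∀ C, parity src tgt C = 0 → (∀ D ⊆ C, D.Nonempty → parity src tgt D = 0 → D = C) →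
      0 ≤ ∑ e ∈ C, w e) (C : Finset E) (hC : parity src tgt C = 0) : 0 ≤ ∑ e ∈ C, w e := by
  induction C using Finset.strongInduction with
  | H C ih =>
    by_cases hmin : ∀ D ⊆ C, D.Nonempty → parity src tgt D = 0 → D = C
    · exact h C hC hmin
    · push Not at hmin
      obtain ⟨D, hDC, hne, hD, hDne⟩ := hmin
      rw [← Finset.sum_sdiff hDC]
      refine add_nonneg (ih _ (Finset.sdiff_ssubset hDC hne) ?_)
        (ih _ (hDC.ssubset_of_ne hDne) hD)
      rw [parity_sdiff hDC, hC, hD, add_zero]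

namespace IsLeastJoin

variable {w : E → ℤ} {a b : V} {F : Finset E}

/-- Removing a nonempty join from a least join strictly increases the weight. -/
theorem sum_neg_of_subset (h : IsLeastJoin src tgt w a b F) {D : Finset E} {x : V}
    (hD : D ⊆ F) (hne : D.Nonempty) (hp : parity src tgt D = pointMass b + pointMass x) :
    ∑ e ∈ D, w e < 0 := by
  by_contra! hnn
  have two := two_eq_zero_parity (V := V)
  have h1 : parity src tgt (F \ D) = pointMass a + pointMass x := by
    rw [parity_sdiff hD, h.parity_eq, hp]
    grind
  have h2 := Finset.sum_sdiff (f := w) hD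
  have h3 := h.card_le a x _ h1 (by omega)
  have h4 := Finset.card_lt_card (Finset.sdiff_ssubset hD hne)
  omega

theorem eq_empty_of_subset (h : IsLeastJoin src tgt w a b F)
    (hw : ∀ C, parity src tgt C = 0 → 0 ≤ ∑ e ∈ C, w e) {D : Finset E}
    (hD : D ⊆ F) (hp : parity src tgt D = 0) : D = ∅ := by
  by_contra hne
  have two := two_eq_zero_parity (V := V)
  have h1 := h.sum_neg_of_subset (x := b) hD (Finset.nonempty_iff_ne_empty.2 hne)
    (hp.trans (by grind))
  have := hw D hp
  omega

variable [Fintype E] {J : Finset E} {c : E → ℤ}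

theorem inter_cutset_eq (h : IsLeastJoin src tgt (signedWeight J c) a b F)
    (hpos : ∀ e, src e ≠ tgt e → 0 < c e) :
    F ∩ cutset src tgt {b} = J ∩ cutset src tgt {b} := by
  have two := two_eq_zero_parity (V := V)
  ext e
  simp only [Finset.mem_inter, and_congr_left_iff]
  intro he
  obtain ⟨y, hyb, hj⟩ := mem_cutset_singleton.1 he
  have hc : 0 < c e := by
    refine hpos e ?_
    rcases hj with ⟨rfl, rfl⟩ | ⟨rfl, rfl⟩
    exacts [hyb.symm, hyb]
  constructor
  · intro heF
    by_contra heJ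
    have h1 := h.sum_neg_of_subset (D := {e}) (x := y) (by simpa using heF) (by simp)
      (by simpa [parity] using hj.pointMass_add)
    simp [signedWeight, heJ] at h1
    omega
  · intro heJ
    by_contra heF
    have h1 := h.weight_le a y (insert e F) (by
      rw [parity_insert heF hj, h.parity_eq]
      grind)
    rw [Finset.sum_insert heF] at h1
    simp only [signedWeight, heJ, if_true] at h1
    omega

theorem card_inter_cutset (h : IsLeastJoin src tgt (signedWeight J c) a b F)
    (hpos : ∀ e, src e ≠ tgt e → 0 < c e)
    (hw : ∀ C, parity src tgt C = 0 → 0 ≤ ∑ e ∈ C, signedWeight J c e) :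
    (J ∩ cutset src tgt {b}).card = 1 := by
  rw [← h.inter_cutset_eq hpos]
  have hab := h.ne hw
  have h1 := card_inter_cutset_le_of_minimal h.parity_eq fun D hD hne hp =>
    absurd (h.eq_empty_of_subset hw hD hp) hne.ne_empty
  rw [if_neg hab] at h1
  obtain ⟨e, he, y, hyb, hj⟩ := exists_joins_of_parity_eq
    (h.parity_eq.trans (add_comm _ _)) hab.symm
  have h2 : 0 < (F ∩ cutset src tgt {b}).card :=
    Finset.card_pos.2 ⟨e, Finset.mem_inter.2 ⟨he, mem_cutset_singleton.2 ⟨y, hyb, hj⟩⟩⟩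
  omega

/-- A minimal cycle through the end of a least join that avoids the last edge of the join has
positive weight. -/
theorem sum_pos_of_minimal (h : IsLeastJoin src tgt w a b F)
    (hw : ∀ C, parity src tgt C = 0 → 0 ≤ ∑ e ∈ C, w e)
    {C : Finset E} (hC : parity src tgt C = 0)
    (hmin : ∀ D ⊆ C, D.Nonempty → parity src tgt D = 0 → D = C)
    (hdisj : ∀ e ∈ F ∩ cutset src tgt {b}, e ∉ C)
    {f : E} (hfC : f ∈ C) (hfb : f ∈ cutset src tgt {b}) (hwf : 0 < w f) :
    0 < ∑ e ∈ C, w e := by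
  by_contra! hle
  have hab := h.ne hw
  have two := two_eq_zero_parity (V := V)
  obtain ⟨y, hyb, hfy⟩ := mem_cutset_singleton.1 hfb
  obtain ⟨e, he, x, hxb, hex⟩ := exists_joins_of_parity_eq
    (h.parity_eq.trans (add_comm _ _)) hab.symm
  have heC := hdisj e (Finset.mem_inter.2 ⟨he, mem_cutset_singleton.2 ⟨x, hxb, hex⟩⟩)
  classical
  let S : Finset (Finset E) := (F \ C).powerset.filter fun Q =>
    Q.Nonempty ∧ ∃ z, parity src tgt Q = pointMass b + pointMass z
  have hS : S.Nonempty := by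
    refine ⟨{e}, ?_⟩
    simp only [S, Finset.mem_filter, Finset.mem_powerset, Finset.singleton_subset_iff,
      Finset.mem_sdiff]
    exact ⟨⟨he, heC⟩, by simp, x, by simpa [parity] using hex.pointMass_add⟩
  obtain ⟨Q, hQS, hQmax⟩ := Finset.exists_max_image S Finset.card hS
  simp only [S, Finset.mem_filter, Finset.mem_powerset] at hQS hQmax
  obtain ⟨hQFC, hQne, z, hQz⟩ := hQS
  have hQF : Q ⊆ F := hQFC.trans Finset.sdiff_subset
  have hQC : Disjoint Q C := Finset.disjoint_of_subset_left hQFC Finset.sdiff_disjoint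
  have hrest : parity src tgt (F \ Q) = pointMass z + pointMass a := by
    rw [parity_sdiff hQF, h.parity_eq, hQz]
    grind
  by_cases hza : z = a
  · subst hza
    have hFQ := h.eq_empty_of_subset hw (D := F \ Q) Finset.sdiff_subset (by rw [hrest]; grind)
    have hFQ : F = Q := (Finset.sdiff_eq_empty_iff_subset.1 hFQ).antisymm hQF
    subst hFQ
    have hd : Disjoint F (C.erase f) :=
      Finset.disjoint_of_subset_right (Finset.erase_subset _ _) hQC
    have h1 := h.weight_le z y (F ∪ C.erase f) (by
      rw [parity_union hd, parity_erase hfC hfy, hC, h.parity_eq]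
      grind)
    rw [Finset.sum_union hd] at h1
    have h2 := Finset.add_sum_erase C w hfC
    omega
  · obtain ⟨g, hg, u, -, hgz⟩ := exists_joins_of_parity_eq hrest hza
    obtain ⟨hgF, hgQ⟩ := Finset.mem_sdiff.1 hg
    have hgC : g ∈ C := by
      by_contra hgC
      have := hQmax (insert g Q) ⟨Finset.insert_subset (Finset.mem_sdiff.2 ⟨hgF, hgC⟩) hQFC,
        Finset.insert_nonempty _ _, u, by
          rw [parity_insert hgQ hgz, hQz]
          grind⟩
      rw [Finset.card_insert_of_notMem hgQ] at this
      omega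
    obtain ⟨D, hDC, hD⟩ := exists_subset_parity_of_minimal hC hmin hfC hfy hgC hgz
    have hd1 : Disjoint Q D := Finset.disjoint_of_subset_right hDC hQC
    have hd2 : Disjoint Q (C \ D) := Finset.disjoint_of_subset_right Finset.sdiff_subset hQC
    have h1 := hw (Q ∪ D) (by rw [parity_union hd1, hQz, hD]; grind)
    have h2 := hw (Q ∪ (C \ D)) (by
      rw [parity_union hd2, parity_sdiff hDC, hQz, hD, hC]
      grind)
    rw [Finset.sum_union hd1] at h1
    rw [Finset.sum_union hd2] at h2
    have h3 := Finset.sum_sdiff (f := w) hDC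
    have h4 := h.sum_neg_of_subset hQF hQne hQz
    omega

/-- Lowering the cost by one on the star of the end of a least join leaves no negative cycle. -/
theorem sum_sub_cutset_nonneg (h : IsLeastJoin src tgt (signedWeight J c) a b F)
    (hpos : ∀ e, src e ≠ tgt e → 0 < c e)
    (heven : ∀ C, parity src tgt C = 0 → Even (∑ e ∈ C, c e))
    (hw : ∀ C, parity src tgt C = 0 → 0 ≤ ∑ e ∈ C, signedWeight J c e)
    (C : Finset E) (hC : parity src tgt C = 0) :
    0 ≤ ∑ e ∈ C, signedWeight J (fun e => c e - if e ∈ cutset src tgt {b} then 1 else 0) e := by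
  have two := two_eq_zero_parity (V := V)
  refine sum_nonneg_of_minimal (src := src) (tgt := tgt) (fun C hC hmin => ?_) C hC
  rw [sum_signedWeight_sub]
  have h2 := card_inter_cutset_le_of_minimal (a := b) (b := b) (hC.trans (by grind)) hmin
  rw [if_pos rfl] at h2
  have hnn := hw C hC
  by_cases hCJ : (C ∩ cutset src tgt {b} ∩ J).Nonempty
  · have := Finset.card_pos.2 hCJ
    omega
  rcases (C ∩ cutset src tgt {b}).eq_empty_or_nonempty with h0 | ⟨f, hf⟩
  · simpa [h0] using hnn
  obtain ⟨hfC, hfb⟩ := Finset.mem_inter.1 hf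
  have hfJ : f ∉ J := fun hfJ => hCJ ⟨f, Finset.mem_inter.2 ⟨hf, hfJ⟩⟩
  have hcf : 0 < c f := by
    obtain ⟨y, hyb, ⟨rfl, rfl⟩ | ⟨rfl, rfl⟩⟩ := mem_cutset_singleton.1 hfb
    exacts [hpos f hyb.symm, hpos f hyb]
  have h3 := h.sum_pos_of_minimal hw hC hmin (fun e he heC => by
    rw [h.inter_cutset_eq hpos] at he
    obtain ⟨heJ, heb⟩ := Finset.mem_inter.1 he
    exact hCJ ⟨e, by simp [heC, heb, heJ]⟩) hfC hfb (by simpa [signedWeight, hfJ] using hcf)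
  obtain ⟨r, hr⟩ := even_sum_signedWeight (J := J) (heven C hC)
  omega

end IsLeastJoin

/-- A cycle of the contracted graph comes from a cycle of the original graph, up to adding or
removing the contracted edge. -/
theorem parity_of_contract {e : E} (he : src e ≠ tgt e) {C : Finset E}
    (hC : parity (contractMap src tgt e ∘ src) (contractMap src tgt e ∘ tgt) C = 0) :
    parity src tgt C = 0 ∨ parity src tgt (symmDiff C {e}) = 0 := by
  have two := two_eq_zero_parity (V := V)
  have hpt : ∀ u v, v ≠ src e → v ≠ tgt e →
      pointMass (contractMap src tgt e u) v = pointMass u v := by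
    intro u v h1 h2
    by_cases hu : u = tgt e
    · rw [contractMap, if_pos hu, hu, pointMass_ne h1.symm, pointMass_ne h2.symm]
    · rw [contractMap, if_neg hu]
  have hpt' : ∀ u, pointMass (contractMap src tgt e u) (src e) =
      pointMass u (src e) + pointMass u (tgt e) := by
    intro u
    by_cases hu : u = tgt e
    · rw [contractMap, if_pos hu, hu, pointMass_self, pointMass_self, pointMass_ne he.symm,
        zero_add]
    · rw [contractMap, if_neg hu, pointMass_ne hu, add_zero]
  have h1 : ∀ v, v ≠ src e → v ≠ tgt e → parity src tgt C v = 0 := by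
    intro v hv1 hv2
    have := congrFun hC v
    simpa [parity, Finset.sum_apply, hpt _ v hv1 hv2] using this
  have h2 : parity src tgt C (src e) + parity src tgt C (tgt e) = 0 := by
    have := congrFun hC (src e)
    simp only [parity, Finset.sum_apply, Function.comp_apply, Pi.add_apply, hpt',
      Pi.zero_apply] at this
    rw [← this]
    simp only [parity, Finset.sum_apply, Pi.add_apply, ← Finset.sum_add_distrib]
    exact Finset.sum_congr rfl fun f _ => by ring
  have hbit : ∀ p q : ZMod 2, p + q = 0 → (p = 0 ∧ q = 0) ∨ (p = 1 ∧ q = 1) := by decide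
  rcases hbit _ _ h2 with ⟨h3, h4⟩ | ⟨h3, h4⟩
  · left
    funext v
    by_cases hv1 : v = src e
    · rw [hv1, h3, Pi.zero_apply]
    by_cases hv2 : v = tgt e
    · rw [hv2, h4, Pi.zero_apply]
    exact h1 v hv1 hv2
  · right
    have h5 : parity src tgt C = pointMass (src e) + pointMass (tgt e) := by
      funext v
      by_cases hv1 : v = src e
      · simp [hv1, h3, pointMass_self, pointMass_ne he.symm]
      by_cases hv2 : v = tgt e
      · simp [hv2, h4, pointMass_self, pointMass_ne he]
      simp [h1 v hv1 hv2, pointMass_ne (Ne.symm hv1), pointMass_ne (Ne.symm hv2)]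
    rw [parity_symmDiff, h5]
    simp only [parity, Finset.sum_singleton]
    grind

theorem sum_symmDiff_singleton {f : E → ℤ} {e : E} (he : f e = 0) (C : Finset E) :
    ∑ x ∈ symmDiff C {e}, f x = ∑ x ∈ C, f x := by
  by_cases h : e ∈ C
  · have : symmDiff C {e} = C.erase e := by
      ext x
      simp only [Finset.mem_symmDiff, Finset.mem_singleton, Finset.mem_erase]
      grind
    rw [this, Finset.sum_erase C he]
  · have : symmDiff C {e} = insert e C := by
      ext x
      simp only [Finset.mem_symmDiff, Finset.mem_singleton, Finset.mem_insert]
      grind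
    rw [this, Finset.sum_insert h, he, zero_add]

/-- If no cycle has negative signed weight, all cycles have even cost and every cut containing
exactly one edge of `J` has at least `k` edges, then `k` times the cost of `J` is at most the
total cost. -/
theorem mul_sum_le_of_conservative [Fintype V] [Fintype E] (J : Finset E) (k n : ℕ) :
    ∀ (src tgt : E → V) (c : E → ℤ), (∀ e, 0 ≤ c e) →
      (∀ C, parity src tgt C = 0 → Even (∑ e ∈ C, c e)) →
      (∀ C, parity src tgt C = 0 → 0 ≤ ∑ e ∈ C, signedWeight J c e) →
      (∀ U, (J ∩ cutset src tgt U).card = 1 → k ≤ (cutset src tgt U).card) →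
      ∑ e, c e + (Finset.univ.filter fun e => src e ≠ tgt e).card ≤ n →
      k * ∑ e ∈ J, c e ≤ ∑ e, c e := by
  induction n with
  | zero =>
    intro src tgt c hc _ _ _ hn
    have h0 : ∑ e, c e = 0 := by
      have := Finset.sum_nonneg fun e (_ : e ∈ Finset.univ) => hc e
      push_cast at hn
      omega
    have h1 := (Finset.sum_eq_zero_iff_of_nonneg fun e _ => hc e).1 h0
    rw [h0, Finset.sum_eq_zero fun e _ => h1 e (Finset.mem_univ e), mul_zero]
  | succ n ih =>
    intro src tgt c hc heven hw hcut hn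
    by_cases hzero : ∃ e, src e ≠ tgt e ∧ c e = 0
    · obtain ⟨e, hne, hce⟩ := hzero
      have hwe : signedWeight J c e = 0 := by simp [signedWeight, hce]
      refine ih (contractMap src tgt e ∘ src) (contractMap src tgt e ∘ tgt) c hc ?_ ?_ ?_ ?_
      · intro C hC
        rcases parity_of_contract hne hC with h | h
        · exact heven C h
        · exact sum_symmDiff_singleton hce C ▸ heven _ h
      · intro C hC
        rcases parity_of_contract hne hC with h | h
        · exact hw C h
        · exact sum_symmDiff_singleton hwe C ▸ hw _ h
      · intro U hU
        rw [cutset_contract] at hU ⊢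
        exact hcut _ hU
      · have : (Finset.univ.filter fun f => (contractMap src tgt e ∘ src) f ≠
            (contractMap src tgt e ∘ tgt) f) ⊂ Finset.univ.filter fun f => src f ≠ tgt f := by
          rw [Finset.ssubset_iff_of_subset]
          · exact ⟨e, by simpa using hne, by
            rw [Finset.mem_filter]
            simp [contractMap]⟩
          · intro f
            simp only [Finset.mem_filter, Finset.mem_univ, true_and, Function.comp_apply]
            exact fun h h' => h (by rw [h'])
        have := Finset.card_lt_card this
        push_cast at hn
        omega
    · have hpos : ∀ e, src e ≠ tgt e → 0 < c e := fun e he =>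
        lt_of_le_of_ne (hc e) fun h => hzero ⟨e, he, h.symm⟩
      by_cases hJ : ∃ e ∈ J, c e ≠ 0
      · obtain ⟨e, heJ, hce⟩ := hJ
        have hwe : signedWeight J c e < 0 := by
          have := hc e
          simp only [signedWeight, heJ, if_true]
          omega
        obtain ⟨a, b, F, hF⟩ := exists_isLeastJoin (src := src) (tgt := tgt) hwe
        have hone := hF.card_inter_cutset hpos hw
        have hk := hcut {b} hone
        have hsum : ∀ C : Finset E,
            ∑ e ∈ C, (c e - if e ∈ cutset src tgt {b} then 1 else 0) =
              ∑ e ∈ C, c e - (C ∩ cutset src tgt {b}).card := by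
          intro C
          rw [Finset.sum_sub_distrib, ← Finset.sum_filter, Finset.filter_mem_eq_inter]
          simp
        have hcard : 0 < (cutset src tgt {b}).card := by
          have := Finset.card_le_card
            (Finset.inter_subset_right (s₁ := J) (s₂ := cutset src tgt {b}))
          omega
        have := ih src tgt (fun e => c e - if e ∈ cutset src tgt {b} then 1 else 0) ?_ ?_
          (hF.sum_sub_cutset_nonneg hpos heven hw) hcut ?_
        · rw [hsum, hsum, hone, Finset.univ_inter] at this
          push_cast at this
          have hk' : (k : ℤ) ≤ (cutset src tgt {b}).card := by exact_mod_cast hk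
          linarith
        · intro f
          have h1 := hc f
          split_ifs with hf
          · obtain ⟨y, hyb, ⟨rfl, rfl⟩ | ⟨rfl, rfl⟩⟩ := mem_cutset_singleton.1 hf
            · have := hpos f hyb.symm
              omega
            · have := hpos f hyb
              omega
          · omega
        · intro C hC
          rw [hsum]
          exact (heven C hC).sub (by exact_mod_cast even_card_inter_cutset hC {b})
        · rw [hsum, Finset.univ_inter]
          push_cast at hn
          omega
      · push Not at hJ
        rw [Finset.sum_eq_zero hJ, mul_zero]
        exact Finset.sum_nonneg fun e _ => hc e

/-- A `2j`-edge-connected graph has a set of at most `|E| / (2j + 1)` edges whose complement has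
all degrees even. -/
theorem exists_small_complement_of_cycle [Fintype V] [Fintype E] {j : ℕ}
    (hec : EdgeConnected src tgt (2 * j)) :
    ∃ J : Finset E, parity src tgt Jᶜ = 0 ∧ (2 * j + 1) * J.card ≤ Fintype.card E := by
  classical
  obtain ⟨J, hJ, hmin⟩ := Finset.exists_min_image
    (Finset.univ.filter fun J : Finset E => parity src tgt Jᶜ = 0) Finset.card
    ⟨Finset.univ, by simp [parity_empty]⟩
  simp only [Finset.mem_filter, Finset.mem_univ, true_and] at hJ hmin
  refine ⟨J, hJ, ?_⟩
  have hmain := mul_sum_le_of_conservative J (2 * j + 1)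
    (2 * Fintype.card E + (Finset.univ.filter fun e => src e ≠ tgt e).card) src tgt
    (fun _ => 2) (by simp) (fun C _ => ?_) (fun C hC => ?_) (fun U hU => ?_) ?_
  · simp only [Finset.sum_const, nsmul_eq_mul, Finset.card_univ] at hmain
    push_cast at hmain
    zify
    linarith
  · rw [Finset.sum_const, nsmul_eq_mul]
    exact (even_two).mul_left _
  · have h1 : (symmDiff J C)ᶜ = symmDiff Jᶜ C := by
      ext x
      simp only [Finset.mem_compl, Finset.mem_symmDiff]
      tauto
    have h2 := hmin (symmDiff J C) (by rw [h1, parity_symmDiff, hJ, hC, add_zero])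
    have h3 : (symmDiff J C).card = (J \ C).card + (C \ J).card := by
      rw [symmDiff, Finset.sup_eq_union, Finset.card_union_of_disjoint disjoint_sdiff_sdiff]
    have h4 := Finset.card_sdiff_add_card_inter J C
    have h5 : ∑ e ∈ C, signedWeight J (fun _ => 2) e = 2 * (C \ J).card - 2 * (J ∩ C).card := by
      rw [← Finset.sum_inter_add_sum_sdiff C J, Finset.inter_comm,
        Finset.sum_congr rfl fun e he => (by
          simp [signedWeight, (Finset.mem_inter.1 he).1] : signedWeight J (fun _ => 2) e = -2),
        Finset.sum_congr (s₁ := C \ J) rfl fun e he => (by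
          simp [signedWeight, (Finset.mem_sdiff.1 he).2] : signedWeight J (fun _ => 2) e = 2)]
      simp only [Finset.sum_const, nsmul_eq_mul]
      ring
    omega
  · have h1 := even_card_inter_cutset hJ U
    have h2 : (cutset src tgt U).card =
        (J ∩ cutset src tgt U).card + (Jᶜ ∩ cutset src tgt U).card := by
      rw [← Finset.card_union_of_disjoint, ← Finset.union_inter_distrib_right,
        Finset.union_compl, Finset.univ_inter]
      exact (disjoint_compl_right (a := J)).mono Finset.inter_subset_left
        Finset.inter_subset_left
    have hne : (cutset src tgt U).Nonempty := by
      rw [← Finset.card_pos]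
      omega
    obtain ⟨e, he⟩ := hne
    simp only [cutset, Finset.mem_filter, Finset.mem_univ, true_and] at he
    have h3 := hec U (by rcases he with ⟨h, -⟩ | ⟨h, -⟩ <;> exact ⟨_, h⟩)
      (by rintro rfl; simp at he)
    obtain ⟨r, hr⟩ := h1
    omega
  · simp only [Finset.sum_const, nsmul_eq_mul, Finset.card_univ]
    push_cast
    linarith

end Joins

/-- For every integer `j ≥ 1`, every `2j`-edge-connected finite graph has an integer
2-flow `φ` (values in `{-1,0,1}`) with `|supp(φ)| ≥ (2j/(2j+1))|E(G)|`. -/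
theorem two_flow_support_even_edge_connected
    (j : ℕ) (hj : 1 ≤ j)
    (V E : Type) [Fintype V] [Fintype E] [DecidableEq V] [DecidableEq E]
    (src tgt : E → V)
    (hec : EdgeConnected src tgt (2 * j)) :
    ∃ φ : E → ℤ,
      (∀ v : V, bdry src tgt φ v = 0) ∧
      (∀ e : E, |φ e| ≤ 1) ∧
      2 * j * Fintype.card E ≤ (2 * j + 1) * (Finset.univ.filter fun e => φ e ≠ 0).card := by
  obtain ⟨J, hJ, hcard⟩ := exists_small_complement_of_cycle hec
  have two := two_eq_zero_parity (V := V)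
  rcases isEmpty_or_nonempty V with hV | ⟨⟨v⟩⟩
  · have : IsEmpty E := ⟨fun e => hV.elim (src e)⟩
    exact ⟨0, fun v => hV.elim v, by simp, by simp⟩
  obtain ⟨φ, h1, h2, h3⟩ := exists_unit_flow Jᶜ v v (hJ.trans (by grind))
  refine ⟨φ, fun x => by rw [h1, sub_self], h2, ?_⟩
  have h4 : (Finset.univ.filter fun e => φ e ≠ 0) = Jᶜ := by
    ext e
    simp only [Finset.mem_filter, Finset.mem_univ, true_and, h3]
  have h5 := Finset.card_add_card_compl J
  rw [h4]
  nlinarith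
end

section
/- Let G be an oriented weighted graph (with weight function μ_G: V(G) → ℤ_3). If P is an inequitable ear of G with |E(P)| = 3k + i where 1 ≤ i ≤ 3, then P has an ear labelling ψ: E(P) → ℤ_3 with gain(ψ) ≥ 8i. If P is an equitable ear, then it has an ear labelling ψ with gain(ψ) = 0. -/
open Finset

/-- Edge `e` joins the vertices `u` and `v` (in one of the two directions). -/
def linked {V E : Type} (src tgt : E → V) (e : E) (u v : V) : Prop :=
  (src e = u ∧ tgt e = v) ∨ (src e = v ∧ tgt e = u)

/-- Data of a candidate ear: a walk `vs 0, es 0, vs 1, …, es (n-1), vs n`. -/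
structure EarData (V E : Type) where
  n : ℕ
  vs : Fin (n + 1) → V
  es : Fin n → E

/-- The edge set of an ear. -/
def EarData.edges {V E : Type} [DecidableEq E] (D : EarData V E) : Finset E :=
  Finset.univ.image D.es

/-- The set of non-isolated vertices of the graph with edge set `F`
(i.e. the vertex set of `(G - (E ∖ F))^×`). -/
def Fverts {V E : Type} [Fintype V] [DecidableEq V] (src tgt : E → V) (F : Finset E) :
    Finset V :=
  Finset.univ.filter fun v => ∃ e ∈ F, src e = v ∨ tgt e = v

/-- `D` is an ear of the graph with vertex set `W` and edge set `F`.  It is a walk with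
pairwise distinct edges, all in `F`, consecutive edges sharing the indicated vertices,
which is one of:
(i) a path (distinct vertices) with at least one edge whose interior vertices have
degree 2 and whose two endpoints have degree at least 3;
(ii) a cycle, based at its unique vertex of degree ≠ 2, all other vertices of degree 2;
(iii) a cycle which is the whole graph (its edges are all of `F` and it passes through
every vertex of `W`). -/
def IsEarOf {V E : Type} [Fintype V] [Fintype E] [DecidableEq V] [DecidableEq E]
    (src tgt : E → V) (W : Finset V) (F : Finset E) (D : EarData V E) : Prop :=
  0 < D.n ∧
  (∀ i : Fin D.n, D.es i ∈ F) ∧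
  Function.Injective D.es ∧
  (∀ i : Fin D.n, linked src tgt (D.es i) (D.vs i.castSucc) (D.vs i.succ)) ∧
  ((Function.Injective D.vs ∧
      (∀ i : Fin (D.n + 1), i ≠ 0 → i ≠ Fin.last D.n → degr src tgt F (D.vs i) = 2) ∧
      3 ≤ degr src tgt F (D.vs 0) ∧ 3 ≤ degr src tgt F (D.vs (Fin.last D.n))) ∨
   (D.vs (Fin.last D.n) = D.vs 0 ∧
      (∀ i j : Fin D.n, D.vs i.castSucc = D.vs j.castSucc → i = j) ∧
      degr src tgt F (D.vs 0) ≠ 2 ∧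
      (∀ i : Fin (D.n + 1), i ≠ 0 → i ≠ Fin.last D.n → degr src tgt F (D.vs i) = 2)) ∨
   (D.vs (Fin.last D.n) = D.vs 0 ∧
      (∀ i j : Fin D.n, D.vs i.castSucc = D.vs j.castSucc → i = j) ∧
      D.edges = F ∧
      (∀ w ∈ W, ∃ i : Fin (D.n + 1), D.vs i = w)))

/-- The boundary of a labelling of the edges of the ear `D`. -/
def earBdry {V E : Type} [DecidableEq V] (src tgt : E → V) (D : EarData V E)
    (ψ : Fin D.n → ZMod 3) (v : V) : ZMod 3 :=
  (∑ i : Fin D.n, if src (D.es i) = v then ψ i else 0) -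
  (∑ i : Fin D.n, if tgt (D.es i) = v then ψ i else 0)

/-- `ψ` is an ear labelling of the ear `D` in a weighted graph with weight function `μ`:
its boundary agrees with `μ` at every interior vertex of the ear. -/
def IsEarLabelling {V E : Type} [DecidableEq V] (src tgt : E → V) (μ : V → ZMod 3)
    (D : EarData V E) (ψ : Fin D.n → ZMod 3) : Prop :=
  ∀ i : Fin (D.n + 1), i ≠ 0 → i ≠ Fin.last D.n →
    earBdry src tgt D ψ (D.vs i) = μ (D.vs i)

/-- The ear `D` is equitable: each of its (three) ear labellings has support of size
exactly two thirds of its number of edges. -/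
def Equitable {V E : Type} [DecidableEq V] (src tgt : E → V) (μ : V → ZMod 3)
    (D : EarData V E) : Prop :=
  ∀ ψ : Fin D.n → ZMod 3, IsEarLabelling src tgt μ D ψ →
    3 * (Finset.univ.filter fun i => ψ i ≠ 0).card = 2 * D.n

/-- The sign of the `i`-th edge of a walk: `1` if the edge is traversed along its orientation,
`-1` otherwise. -/
def EarData.sign {V E : Type} [DecidableEq V] (src tgt : E → V) (D : EarData V E)
    (i : Fin D.n) : ZMod 3 :=
  if src (D.es i) = D.vs i.castSucc ∧ tgt (D.es i) = D.vs i.succ then 1 else -1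

lemma EarData.sign_mul_self {V E : Type} [DecidableEq V] (src tgt : E → V) (D : EarData V E)
    (i : Fin D.n) : D.sign src tgt i * D.sign src tgt i = 1 := by
  unfold EarData.sign
  split_ifs <;> simp

/-- The interior vertices of an ear are visited only once. -/
lemma IsEarOf.eq_of_vs_eq {V E : Type} [Fintype V] [Fintype E] [DecidableEq V] [DecidableEq E]
    {src tgt : E → V} {W : Finset V} {F : Finset E} {D : EarData V E}
    (hD : IsEarOf src tgt W F D) {p q : Fin (D.n + 1)} (hp0 : p ≠ 0) (hpl : p ≠ Fin.last D.n)
    (h : D.vs q = D.vs p) : q = p := by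
  obtain ⟨hn, -, -, -, hcases⟩ := hD
  have hcycle (hclose : D.vs (Fin.last D.n) = D.vs 0)
      (hinj : ∀ i j : Fin D.n, D.vs i.castSucc = D.vs j.castSucc → i = j) : q = p := by
    obtain ⟨a, rfl⟩ := Fin.exists_castSucc_eq.2 hpl
    by_cases hq : q = Fin.last D.n
    · have hz : (⟨0, hn⟩ : Fin D.n).castSucc = 0 := rfl
      rw [hq, hclose, ← hz] at h
      exact absurd (by rw [← hinj _ _ h, hz]) hp0
    · obtain ⟨b, rfl⟩ := Fin.exists_castSucc_eq.2 hq
      rw [hinj _ _ h]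
  rcases hcases with ⟨hinj, -⟩ | ⟨hclose, hinj, -⟩ | ⟨hclose, hinj, -⟩
  · exact hinj h
  · exact hcycle hclose hinj
  · exact hcycle hclose hinj

/-- At an interior vertex, entered through the edge `b` and left through the edge `a`, the
boundary is the difference of the signed labels of `a` and `b`. -/
lemma IsEarOf.earBdry_eq {V E : Type} [Fintype V] [Fintype E] [DecidableEq V] [DecidableEq E]
    {src tgt : E → V} {W : Finset V} {F : Finset E} {D : EarData V E}
    (hD : IsEarOf src tgt W F D) (ψ : Fin D.n → ZMod 3) {a b : Fin D.n}
    (hab : a.castSucc = b.succ) :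
    earBdry src tgt D ψ (D.vs a.castSucc) =
      D.sign src tgt a * ψ a - D.sign src tgt b * ψ b := by
  have h0 : a.castSucc ≠ 0 := hab ▸ Fin.succ_ne_zero b
  have hl : a.castSucc ≠ Fin.last D.n := Fin.castSucc_ne_last a
  have huniq (q : Fin (D.n + 1)) : D.vs q = D.vs a.castSucc ↔ q = a.castSucc :=
    ⟨fun h => hD.eq_of_vs_eq h0 hl h, fun h => by rw [h]⟩
  have hedge (i : Fin D.n) :
      ((if src (D.es i) = D.vs a.castSucc then ψ i else 0) -
        if tgt (D.es i) = D.vs a.castSucc then ψ i else 0) =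
      (if i = a then D.sign src tgt i * ψ i else 0) -
        if i = b then D.sign src tgt i * ψ i else 0 := by
    have hsrc : D.vs i.castSucc = D.vs a.castSucc ↔ i = a := by
      rw [huniq, Fin.castSucc_inj]
    have htgt : D.vs i.succ = D.vs a.castSucc ↔ i = b := by
      rw [huniq, hab, Fin.succ_inj]
    rw [← if_congr hsrc rfl rfl, ← if_congr htgt rfl rfl]
    unfold EarData.sign
    rcases hD.2.2.2.1 i with ⟨h1, h2⟩ | ⟨h1, h2⟩
    · simp [h1, h2]
    · rw [h1, h2]
      split_ifs <;> simp_all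
  unfold earBdry
  rw [← Finset.sum_sub_distrib, Finset.sum_congr rfl fun i _ => hedge i,
    Finset.sum_sub_distrib]
  simp

/-- A labelling of an ear is an ear labelling iff its signed labels increase by the weight of
each interior vertex. -/
lemma IsEarOf.isEarLabelling_iff {V E : Type} [Fintype V] [Fintype E] [DecidableEq V]
    [DecidableEq E] {src tgt : E → V} {W : Finset V} {F : Finset E} {D : EarData V E}
    (hD : IsEarOf src tgt W F D) (μ : V → ZMod 3) (ψ : Fin D.n → ZMod 3) :
    IsEarLabelling src tgt μ D ψ ↔ ∀ a b : Fin D.n, a.castSucc = b.succ →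
      D.sign src tgt a * ψ a - D.sign src tgt b * ψ b = μ (D.vs a.castSucc) := by
  constructor
  · intro h a b hab
    rw [← hD.earBdry_eq ψ hab]
    exact h _ (hab ▸ Fin.succ_ne_zero b) (Fin.castSucc_ne_last a)
  · intro h p hp0 hpl
    obtain ⟨a, rfl⟩ := Fin.exists_castSucc_eq.2 hpl
    obtain ⟨b, hb⟩ := Fin.exists_succ_eq.2 hp0
    rw [hD.earBdry_eq ψ hb.symm, h a b hb.symm]

/-- Every ear has an ear labelling. -/
lemma IsEarOf.exists_isEarLabelling {V E : Type} [Fintype V] [Fintype E] [DecidableEq V]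
    [DecidableEq E] {src tgt : E → V} {W : Finset V} {F : Finset E} {D : EarData V E}
    (hD : IsEarOf src tgt W F D) (μ : V → ZMod 3) :
    ∃ ψ : Fin D.n → ZMod 3, IsEarLabelling src tgt μ D ψ := by
  let w : ℕ → ZMod 3 := fun j => if h : j < D.n + 1 then μ (D.vs ⟨j, h⟩) else 0
  refine ⟨fun i => D.sign src tgt i * ∑ j ∈ Finset.range (i + 1), w j,
    (hD.isEarLabelling_iff μ _).2 fun a b hab => ?_⟩
  have hval : (a : ℕ) = b + 1 := congrArg Fin.val hab
  have hw : w a = μ (D.vs a.castSucc) := dif_pos a.castSucc.isLt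
  rw [← mul_assoc, ← mul_assoc, EarData.sign_mul_self, EarData.sign_mul_self, one_mul, one_mul,
    Finset.sum_range_succ, hw, hval, add_sub_cancel_left]

/-- Shifting all signed labels by a constant preserves ear labellings. -/
lemma IsEarOf.isEarLabelling_shift {V E : Type} [Fintype V] [Fintype E] [DecidableEq V]
    [DecidableEq E] {src tgt : E → V} {W : Finset V} {F : Finset E} {D : EarData V E}
    (hD : IsEarOf src tgt W F D) {μ : V → ZMod 3} {ψ : Fin D.n → ZMod 3}
    (hψ : IsEarLabelling src tgt μ D ψ) (c : ZMod 3) :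
    IsEarLabelling src tgt μ D fun i => ψ i + D.sign src tgt i * c := by
  rw [hD.isEarLabelling_iff] at hψ ⊢
  intro a b hab
  rw [← hψ a b hab]
  linear_combination c * EarData.sign_mul_self src tgt D a -
    c * EarData.sign_mul_self src tgt D b

/-- The supports of the three shifts of a labelling have total size twice the number of edges. -/
lemma EarData.sum_card_support_shift {V E : Type} [DecidableEq V] (src tgt : E → V)
    (D : EarData V E) (ψ : Fin D.n → ZMod 3) :
    ∑ c : ZMod 3, (Finset.univ.filter fun i => ψ i + D.sign src tgt i * c ≠ 0).card =
      2 * D.n := by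
  have hfiber : ∀ x s : ZMod 3, s * s = 1 →
      (∑ c : ZMod 3, if x + s * c ≠ 0 then 1 else 0) = 2 := by decide
  simp_rw [Finset.card_filter]
  rw [Finset.sum_comm,
    Finset.sum_congr rfl fun i _ => hfiber (ψ i) _ (D.sign_mul_self src tgt i)]
  simp [mul_comm]

/-- Let `G` be an oriented weighted graph.  If `P` is an inequitable ear of `G` with
`|E(P)| = 3k + i` where `1 ≤ i ≤ 3`, then `P` has an ear labelling `ψ` with
`gain(ψ) = 24|supp(ψ)| − 16|E(P)| ≥ 8i`.  If `P` is equitable, then it has an ear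
labelling `ψ` with `gain(ψ) = 0`. -/
theorem good_gain_ear_labelling
    (V E : Type) [Fintype V] [Fintype E] [DecidableEq V] [DecidableEq E]
    (src tgt : E → V) (μ : V → ZMod 3)
    (P : EarData V E) (hP : IsEarOf src tgt Finset.univ Finset.univ P) :
    (¬ Equitable src tgt μ P →
      ∀ k i : ℕ, 1 ≤ i → i ≤ 3 → P.n = 3 * k + i →
        ∃ ψ : Fin P.n → ZMod 3, IsEarLabelling src tgt μ P ψ ∧
          8 * (i : ℤ) ≤ 24 * ((Finset.univ.filter fun j => ψ j ≠ 0).card : ℤ)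
            - 16 * (P.n : ℤ)) ∧
    (Equitable src tgt μ P →
      ∃ ψ : Fin P.n → ZMod 3, IsEarLabelling src tgt μ P ψ ∧
        24 * ((Finset.univ.filter fun j => ψ j ≠ 0).card : ℤ) - 16 * (P.n : ℤ) = 0) := by
  refine ⟨fun hne k i hi1 hi3 hn => ?_, fun heq => ?_⟩
  · unfold Equitable at hne
    push Not at hne
    obtain ⟨ψ, hψ, hcard⟩ := hne
    let f : ZMod 3 → ℕ := fun c =>
      (Finset.univ.filter fun j => ψ j + P.sign src tgt j * c ≠ 0).card
    have hsum : f 0 + f 1 + f 2 = 2 * P.n := by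
      rw [← P.sum_card_support_shift src tgt ψ]
      exact (Fin.sum_univ_three f).symm
    have hf0 : 3 * f 0 ≠ 2 * P.n := by simpa [f] using hcard
    obtain ⟨c, hc⟩ : ∃ c, 2 * k + i ≤ f c := by
      by_contra! h
      have h0 := h 0
      have h1 := h 1
      have h2 := h 2
      omega
    refine ⟨_, hP.isEarLabelling_shift hψ c, ?_⟩
    change 8 * (i : ℤ) ≤ 24 * (f c : ℤ) - 16 * (P.n : ℤ)
    omega
  · obtain ⟨ψ, hψ⟩ := hP.exists_isEarLabelling μ
    have hcard := heq ψ hψ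
    exact ⟨ψ, hψ, by omega⟩
end

section
/- A tripod is the graph obtained from K_3 by adding one pendant edge to each of its three vertices. Let G be a graph obtained from a disjoint collection of tripods by identifying their leaves (so that every edge of G belongs to exactly one tripod). Then every integer 3-flow φ of G satisfies |supp(φ)| ≤ (5/6)|E(G)|; in fact every 3-flow assigns the value 0 to at least one edge of each tripod. -/
open Finset

/-- The flow leaving `v` along `e`; a loop contributes `0`. -/
def outflow {V E A : Type} [DecidableEq V] [AddCommGroup A]
    (src tgt : E → V) (φ : E → A) (v : V) (e : E) : A :=
  (if src e = v then φ e else 0) - (if tgt e = v then φ e else 0)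

/-- The number of ends of `e` at `v`; a loop at `v` counts twice. -/
def endCount {V E : Type} [DecidableEq V] (src tgt : E → V) (v : V) (e : E) : ℕ :=
  (if src e = v then 1 else 0) + (if tgt e = v then 1 else 0)

theorem sum_outflow {V E A : Type} [Fintype E] [DecidableEq V] [AddCommGroup A]
    (src tgt : E → V) (φ : E → A) (v : V) :
    ∑ e, outflow src tgt φ v e = bdry src tgt φ v := by
  simp [outflow, bdry]

theorem sum_endCount {V E : Type} [DecidableEq V]
    (src tgt : E → V) (F : Finset E) (v : V) :
    ∑ e ∈ F, endCount src tgt v e = degr src tgt F v := by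
  simp [endCount, degr, Finset.sum_add_distrib]

theorem linked.symm {V E : Type} {src tgt : E → V} {e : E} {u v : V}
    (h : linked src tgt e u v) : linked src tgt e v u :=
  Or.symm h

theorem linked.one_le_endCount {V E : Type} [DecidableEq V] {src tgt : E → V} {e : E} {u v : V}
    (h : linked src tgt e u v) : 1 ≤ endCount src tgt u e := by
  rcases h with ⟨h, -⟩ | ⟨-, h⟩ <;> simp [endCount, h]

theorem linked.outflow_right {V E A : Type} [DecidableEq V] [AddCommGroup A]
    {src tgt : E → V} {e : E} {u v : V} (h : linked src tgt e u v) (huv : u ≠ v) (φ : E → A) :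
    outflow src tgt φ v e = -outflow src tgt φ u e := by
  rcases h with ⟨h₁, h₂⟩ | ⟨h₁, h₂⟩ <;> simp [outflow, h₁, h₂, huv, huv.symm]

theorem abs_outflow_of_endCount_eq_one {V E : Type} [DecidableEq V]
    {src tgt : E → V} {e : E} {v : V} (h : endCount src tgt v e = 1) (φ : E → ℤ) :
    |outflow src tgt φ v e| = |φ e| := by
  unfold endCount at h
  unfold outflow
  split_ifs at h ⊢ <;> simp_all

theorem outflow_eq_zero_iff_of_endCount_eq_one {V E : Type} [DecidableEq V]
    {src tgt : E → V} {e : E} {v : V} (h : endCount src tgt v e = 1) (φ : E → ℤ) :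
    outflow src tgt φ v e = 0 ↔ φ e = 0 := by
  rw [← abs_eq_zero, abs_outflow_of_endCount_eq_one h, abs_eq_zero]

/-- Three nonzero integers in `[-2, 2]` cannot be distinct and differ pairwise by at most 2. -/
theorem exists_zero_of_cyclic_differences {x y z p q r : ℤ}
    (hp : x - z + p = 0) (hq : y - x + q = 0) (hr : z - y + r = 0)
    (hx : |x| ≤ 2) (hy : |y| ≤ 2) (hz : |z| ≤ 2) (hp₂ : |p| ≤ 2) (hq₂ : |q| ≤ 2) (hr₂ : |r| ≤ 2) :
    x = 0 ∨ y = 0 ∨ z = 0 ∨ p = 0 ∨ q = 0 ∨ r = 0 := by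
  rw [abs_le] at *
  omega

/-- Three distinct edges at a vertex of degree 3 are all the edges there, and none is a loop. -/
theorem outflow_at_cubic_vertex {V E A : Type} [Fintype E] [DecidableEq V] [DecidableEq E]
    [AddCommGroup A] {src tgt : E → V} {φ : E → A} {v x y z : V} {e f g : E}
    (hef : e ≠ f) (heg : e ≠ g) (hfg : f ≠ g)
    (he : linked src tgt e v x) (hf : linked src tgt f v y) (hg : linked src tgt g v z)
    (hdeg : degr src tgt Finset.univ v = 3) :
    outflow src tgt φ v e + outflow src tgt φ v f + outflow src tgt φ v g = bdry src tgt φ v ∧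
      endCount src tgt v e = 1 ∧ endCount src tgt v f = 1 ∧ endCount src tgt v g = 1 := by
  have hsum : ∑ k ∈ ({e, f, g} : Finset E), endCount src tgt v k =
      endCount src tgt v e + (endCount src tgt v f + endCount src tgt v g) := by
    rw [Finset.sum_insert (by simp [hef, heg]), Finset.sum_pair hfg]
  have hsplit := Finset.sum_add_sum_compl ({e, f, g} : Finset E) (endCount src tgt v)
  rw [sum_endCount src tgt Finset.univ, hdeg, hsum] at hsplit
  have he₁ := he.one_le_endCount
  have hf₁ := hf.one_le_endCount
  have hg₁ := hg.one_le_endCount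
  refine ⟨?_, by omega, by omega, by omega⟩
  have hrest : ∑ k ∈ ({e, f, g} : Finset E)ᶜ, endCount src tgt v k = 0 := by omega
  rw [Finset.sum_eq_zero_iff] at hrest
  rw [← sum_outflow, ← Finset.sum_subset (Finset.subset_univ ({e, f, g} : Finset E)),
    Finset.sum_insert (by simp [hef, heg]), Finset.sum_pair hfg, add_assoc]
  intro k _ hk
  have hk₀ := hrest k (Finset.mem_compl.mpr hk)
  unfold endCount at hk₀
  unfold outflow
  split_ifs at hk₀ ⊢ <;> simp_all

/-- If `ι × Fin (n + 1)` is in bijection with `E` and each fibre over `ι` meets the zero set of `φ`,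
then at most a fraction `n / (n + 1)` of `E` lies in the support of `φ`. -/
theorem mul_card_support_le_of_fibres {E ι : Type} [Fintype E] [Fintype ι] {n : ℕ}
    {t : ι × Fin (n + 1) → E} (ht : Function.Bijective t) {φ : E → ℤ}
    (hzero : ∀ i, ∃ k, φ (t (i, k)) = 0) :
    (n + 1) * (Finset.univ.filter fun e => φ e ≠ 0).card ≤ n * Fintype.card E := by
  choose k hk using hzero
  have hcard : Fintype.card E = Fintype.card ι * (n + 1) := by
    simp [← Fintype.card_of_bijective ht]
  have hle : Fintype.card ι ≤ (Finset.univ.filter fun e => φ e = 0).card := by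
    rw [← Finset.card_univ]
    refine Finset.card_le_card_of_injOn (fun i => t (i, k i)) (by simp [Set.MapsTo, hk]) ?_
    intro i _ j _ hij
    exact congrArg Prod.fst (ht.1 hij)
  have hadd := Finset.card_filter_add_card_filter_not (s := (Finset.univ : Finset E))
    (fun e => φ e = 0)
  rw [Finset.card_univ, hcard] at hadd
  rw [hcard]
  have hsupp : (Finset.univ.filter fun e => φ e ≠ 0).card ≤ n * Fintype.card ι := by
    simp only [ne_eq]
    linarith
  calc _ ≤ (n + 1) * (n * Fintype.card ι) := Nat.mul_le_mul_left _ hsupp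
    _ = _ := by ring

/-- A tripod is `K₃` with a pendant edge added at each of its three vertices.
Suppose the finite graph `(V, E, src, tgt)` is obtained from a disjoint collection of
tripods (indexed by `ι`) by identifying their leaves: tripod `i` has triangle vertices
`a i, b i, c i` (which have degree 3 in `G`, so belong to no other tripod), triangle
edges `tab i, tbc i, tca i`, and pendant edges `pa i, pb i, pc i` joining `a i, b i, c i`
to the (identified) leaf vertices `la i, lb i, lc i`; every edge of `G` lies in exactly
one tripod.  Then every integer 3-flow `φ` of `G` assigns the value `0` to at least one
edge of each tripod, and consequently `|supp(φ)| ≤ (5/6)|E(G)|`. -/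
theorem tripod_union_three_flow_bound
    (V E ι : Type) [Fintype V] [Fintype E] [Fintype ι] [DecidableEq V] [DecidableEq E]
    (src tgt : E → V)
    (a b c la lb lc : ι → V)
    (tab tbc tca pa pb pc : ι → E)
    (hcover : Function.Bijective
      (fun x : ι × Fin 6 => ![tab x.1, tbc x.1, tca x.1, pa x.1, pb x.1, pc x.1] x.2))
    (hdist : ∀ i : ι, a i ≠ b i ∧ b i ≠ c i ∧ a i ≠ c i)
    (htab : ∀ i : ι, linked src tgt (tab i) (a i) (b i))
    (htbc : ∀ i : ι, linked src tgt (tbc i) (b i) (c i))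
    (htca : ∀ i : ι, linked src tgt (tca i) (c i) (a i))
    (hpa : ∀ i : ι, linked src tgt (pa i) (a i) (la i))
    (hpb : ∀ i : ι, linked src tgt (pb i) (b i) (lb i))
    (hpc : ∀ i : ι, linked src tgt (pc i) (c i) (lc i))
    (hdega : ∀ i : ι, degr src tgt Finset.univ (a i) = 3)
    (hdegb : ∀ i : ι, degr src tgt Finset.univ (b i) = 3)
    (hdegc : ∀ i : ι, degr src tgt Finset.univ (c i) = 3)
    (φ : E → ℤ)
    (hflow : ∀ v : V, bdry src tgt φ v = 0)
    (hbound : ∀ e : E, |φ e| ≤ 2) :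
    (∀ i : ι, φ (tab i) = 0 ∨ φ (tbc i) = 0 ∨ φ (tca i) = 0 ∨
       φ (pa i) = 0 ∨ φ (pb i) = 0 ∨ φ (pc i) = 0) ∧
    6 * (Finset.univ.filter fun e => φ e ≠ 0).card ≤ 5 * Fintype.card E := by
  have hzero : ∀ i : ι, φ (tab i) = 0 ∨ φ (tbc i) = 0 ∨ φ (tca i) = 0 ∨
      φ (pa i) = 0 ∨ φ (pb i) = 0 ∨ φ (pc i) = 0 := by
    intro i
    have hne : ∀ j k : Fin 6, j ≠ k →
        ![tab i, tbc i, tca i, pa i, pb i, pc i] j ≠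
          ![tab i, tbc i, tca i, pa i, pb i, pc i] k :=
      fun j k hjk h => hjk (congrArg Prod.snd (hcover.1 (a₁ := (i, j)) (a₂ := (i, k)) h))
    obtain ⟨hab, hbc, hac⟩ := hdist i
    obtain ⟨sa, a₁, -, a₃⟩ := outflow_at_cubic_vertex (φ := φ)
      (e := tab i) (f := tca i) (g := pa i)
      (hne 0 2 (by decide)) (hne 0 3 (by decide)) (hne 2 3 (by decide))
      (htab i) (htca i).symm (hpa i) (hdega i)
    obtain ⟨sb, b₁, -, b₃⟩ := outflow_at_cubic_vertex (φ := φ)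
      (e := tbc i) (f := tab i) (g := pb i)
      (hne 1 0 (by decide)) (hne 1 4 (by decide)) (hne 0 4 (by decide))
      (htbc i) (htab i).symm (hpb i) (hdegb i)
    obtain ⟨sc, c₁, -, c₃⟩ := outflow_at_cubic_vertex (φ := φ)
      (e := tca i) (f := tbc i) (g := pc i)
      (hne 2 1 (by decide)) (hne 2 5 (by decide)) (hne 1 5 (by decide))
      (htca i) (htbc i).symm (hpc i) (hdegc i)
    rw [hflow] at sa sb sc
    have rab := (htab i).outflow_right hab φ
    have rbc := (htbc i).outflow_right hbc φ
    have rca := (htca i).outflow_right hac.symm φ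
    have hle : ∀ {v : V} {e : E}, endCount src tgt v e = 1 → |outflow src tgt φ v e| ≤ 2 :=
      fun h => (abs_outflow_of_endCount_eq_one h φ).trans_le (hbound _)
    have hout := exists_zero_of_cyclic_differences
      (x := outflow src tgt φ (a i) (tab i)) (y := outflow src tgt φ (b i) (tbc i))
      (z := outflow src tgt φ (c i) (tca i)) (p := outflow src tgt φ (a i) (pa i))
      (q := outflow src tgt φ (b i) (pb i)) (r := outflow src tgt φ (c i) (pc i))
      (by linarith) (by linarith) (by linarith)
      (hle a₁) (hle b₁) (hle c₁) (hle a₃) (hle b₃) (hle c₃)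
    simpa only [outflow_eq_zero_iff_of_endCount_eq_one, a₁, b₁, c₁, a₃, b₃, c₃] using hout
  refine ⟨hzero, mul_card_support_le_of_fibres hcover fun i => ?_⟩
  rcases hzero i with h | h | h | h | h | h
  exacts [⟨0, h⟩, ⟨1, h⟩, ⟨2, h⟩, ⟨3, h⟩, ⟨4, h⟩, ⟨5, h⟩]
end
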